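/- arXiv:1008.2043 — 7 statements merged into one kernel-verified Lean document; each statement's English description precedes it below -/
import Mathlib

section
/- If q ≡ 3 (mod 4) is a prime power and q + 2 is also a prime power, then there exists a symmetric conference matrix of order q²(q+2) + 1 and a symmetric Hadamard matrix of order 2q²(q+2) + 2. -/
/-- A Hadamard matrix of order `n`: entries `±1` and `H * Hᵀ = n • I`. -/
def IsHadamard (n : ℕ) (H : Matrix (Fin n) (Fin n) ℤ) : Prop :=
  (∀ i j, H i j = 1 ∨ H i j = -1) ∧ H * H.transpose = (n : ℤ) • 1

/-- A conference matrix of order `n`: zero diagonal, off-diagonal entries `±1`,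
and `C * Cᵀ = (n - 1) • I`. -/
def IsConference (n : ℕ) (C : Matrix (Fin n) (Fin n) ℤ) : Prop :=
  (∀ i, C i i = 0) ∧ (∀ i j, i ≠ j → C i j = 1 ∨ C i j = -1) ∧
    C * C.transpose = ((n : ℤ) - 1) • 1

open Finset

/-! ### Quadratic characters -/

theorem quadraticChar_sum_mul_sub {F : Type*} [Field F] [Fintype F] [DecidableEq F]
    (hF : ringChar F ≠ 2) {c : F} (hc : c ≠ 0) :
    ∑ a, quadraticChar F a * quadraticChar F (c - a) = -quadraticChar F (-1) := by
  have h := jacobiSum_nontrivial_inv (quadraticChar_ne_one hF)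
  rw [(quadraticChar_isQuadratic F).inv] at h
  rw [← h, jacobiSum, ← Equiv.sum_comp (Equiv.mulLeft₀ c hc)]
  refine sum_congr rfl fun a _ => ?_
  have e : c - c * a = c * (1 - a) := by ring
  simp only [Equiv.mulLeft₀_apply]
  rw [e, map_mul, map_mul]
  linear_combination (quadraticChar F a * quadraticChar F (1 - a)) * quadraticChar_sq_one hc

/-- The quadratic character of a finite field, modified to take the value `1` at `0`. -/
def quadraticSign (F : Type*) [Field F] [Fintype F] [DecidableEq F] (a : F) : ℤ :=
  quadraticChar F a + if a = 0 then 1 else 0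

section quadraticSign

variable {F : Type*} [Field F] [Fintype F] [DecidableEq F]

theorem quadraticSign_eq (a : F) : quadraticSign F a = 1 ∨ quadraticSign F a = -1 := by
  by_cases h : a = 0
  · simp [quadraticSign, h]
  · simpa [quadraticSign, h] using quadraticChar_dichotomy h

theorem sum_quadraticSign (hF : ringChar F ≠ 2) : ∑ a, quadraticSign F a = 1 := by
  simp only [quadraticSign, sum_add_distrib, quadraticChar_sum_zero hF, sum_ite_eq', mem_univ, if_true,
    zero_add]

theorem sum_quadraticSign_mul (hF : ringChar F ≠ 2) (h1 : quadraticChar F (-1) = -1) (u v : F) :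
    ∑ a, quadraticSign F (u - a) * quadraticSign F (v - a) =
      (Fintype.card F + 1) * (if u = v then 1 else 0) - 1 := by
  by_cases huv : u = v
  · subst huv
    have : ∀ a, quadraticSign F (u - a) * quadraticSign F (u - a) = 1 := fun a => by
      rcases quadraticSign_eq (u - a) with h | h <;> simp [h]
    simp [this]
  · have hneg : ∀ a : F, quadraticChar F (-a) = -quadraticChar F a := fun a => by
      rw [← neg_one_mul, map_mul, h1]; ring
    have key := quadraticChar_sum_mul_sub hF (sub_ne_zero.2 huv)
    rw [← Equiv.sum_comp (Equiv.subLeft u)] at key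
    have hterm : ∀ a, quadraticSign F (u - a) * quadraticSign F (v - a) =
        -(quadraticChar F (u - a) * quadraticChar F (u - v - (u - a)))
          + (if a = u then quadraticChar F (v - u) else 0)
          + (if a = v then quadraticChar F (u - v) else 0) := fun a => by
      have e : u - v - (u - a) = -(v - a) := by ring
      rw [e, hneg]
      unfold quadraticSign
      by_cases h : a = u
      · subst h; simp [huv, sub_eq_zero, Ne.symm huv]
      · by_cases h' : a = v
        · subst h'; simp [h, sub_eq_zero, Ne.symm h]
        · simp [h, h', sub_eq_zero, Ne.symm h, Ne.symm h']
    have e : quadraticChar F (v - u) = -quadraticChar F (u - v) := by rw [← hneg]; simp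
    simp only [Equiv.subLeft_apply] at key
    simp only [hterm, sum_add_distrib, sum_neg_distrib, key, h1, sum_ite_eq', mem_univ, if_true, e,
      if_neg huv]
    ring

theorem sum_quadraticSign_mul_left (hF : ringChar F ≠ 2) {σ : F} (hσ : σ ≠ 0) (b : F) :
    ∑ a, quadraticSign F (σ * (a - b)) = 1 := by
  rw [← sum_quadraticSign hF]
  exact Equiv.sum_comp ((Equiv.subRight b).trans (Equiv.mulLeft₀ σ hσ)) (quadraticSign F)

theorem sum_quadraticSign_mul_left' (hF : ringChar F ≠ 2) {σ : F} (hσ : σ ≠ 0) (b : F) :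
    ∑ a, quadraticSign F (σ * (b - a)) = 1 := by
  rw [← sum_quadraticSign_mul_left hF (neg_ne_zero.2 hσ) b]
  exact sum_congr rfl fun a _ => by congr 1; ring

theorem sum_quadraticSign_mul_scaled (hF : ringChar F ≠ 2) (h1 : quadraticChar F (-1) = -1)
    {σ : F} (hσ : σ ≠ 0) (u v : F) :
    ∑ a, quadraticSign F (σ * (u - a)) * quadraticSign F (σ * (v - a)) =
      (Fintype.card F + 1) * (if u = v then 1 else 0) - 1 := by
  have h := sum_quadraticSign_mul hF h1 (σ * u) (σ * v)
  rw [← Equiv.sum_comp (Equiv.mulLeft₀ σ hσ)] at h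
  simpa [mul_sub, hσ] using h

end quadraticSign

/-! ### Parallel classes of the affine plane -/

theorem neg_ne_self_of_ringChar_ne_two {V : Type*} [Field V] (hV : ringChar V ≠ 2) {t : V}
    (ht : t ≠ 0) : -t ≠ t := fun h =>
  ht ((Ring.eq_self_iff_eq_zero_of_char_ne_two hV).1 h)

/-- An odd function with values `±1` away from `0`. -/
structure IsOddSign {V : Type*} [AddGroup V] (τ : V → ℤ) : Prop where
  neg : ∀ t, τ (-t) = -τ t
  sq : ∀ t, t ≠ 0 → τ t ^ 2 = 1

/-- A family of functions from the affine plane `F × F` to `F`, indexed by the nonzero elements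
of `V`, whose fibres are the parallel classes of lines. -/
structure IsParallelFamily {V F : Type*} [AddGroup V] [Fintype V] [DecidableEq V] [Fintype F]
    [DecidableEq F] (π : V → F × F → F) : Prop where
  bijective : ∀ t u, t ≠ 0 → u ≠ 0 → t ≠ u → Function.Bijective fun z => (π t z, π u z)
  sum_eq : ∀ x y, ∑ t, (if t ≠ 0 ∧ π t x = π t y then 1 else 0 : ℤ) =
    1 + Fintype.card F * (if x = y then 1 else 0)

theorem exists_isOddSign (V : Type*) [Field V] [Fintype V] (hV : ringChar V ≠ 2) :
    ∃ τ : V → ℤ, IsOddSign τ := by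
  refine ⟨fun t => Int.sign ((Fintype.equivFin V t : ℕ) - (Fintype.equivFin V (-t) : ℕ) : ℤ),
    fun t => ?_, fun t ht => ?_⟩
  · rw [neg_neg, ← Int.sign_neg, neg_sub]
  · have : (Fintype.equivFin V t : ℕ) ≠ (Fintype.equivFin V (-t) : ℕ) := fun h =>
      neg_ne_self_of_ringChar_ne_two hV ht ((Fintype.equivFin V).injective (Fin.ext h)).symm
    rcases lt_or_gt_of_ne this with h | h
    · rw [Int.sign_eq_neg_one_of_neg (by omega)]; norm_num
    · rw [Int.sign_eq_one_of_pos (by omega)]; norm_num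

/-- The coordinate functions whose fibres are the lines with a given slope. -/
def slopeCoord {F : Type*} [Field F] : Option (Option F) → F × F → F
  | none, _ => 0
  | some none, z => z.1
  | some (some m), z => z.2 + m * z.1

theorem slopeCoord_bijective {F : Type*} [Field F] [Fintype F] {s r : Option F} (h : s ≠ r) :
    Function.Bijective fun z : F × F => (slopeCoord (some s) z, slopeCoord (some r) z) := by
  refine Finite.injective_iff_bijective.1 ?_
  rintro ⟨a, b⟩ ⟨c, d⟩ hz
  rcases s with _ | m <;> rcases r with _ | n <;> simp only [slopeCoord, Prod.mk.injEq] at hz ⊢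
  · exact absurd rfl h
  · obtain ⟨rfl, h2⟩ := hz
    simpa using h2
  · obtain ⟨h2, rfl⟩ := hz
    simpa using h2
  · have hmn : m - n ≠ 0 := sub_ne_zero.2 fun e => h (by rw [e])
    have : a = c := mul_left_cancel₀ hmn (by linear_combination hz.1 - hz.2)
    subst this
    exact ⟨rfl, by simpa using hz.1⟩

theorem sum_slopeCoord {F : Type*} [Field F] [Fintype F] [DecidableEq F] (x y : F × F) :
    ∑ s : Option F, (if slopeCoord (some s) x = slopeCoord (some s) y then 1 else 0 : ℤ) =
      1 + Fintype.card F * if x = y then 1 else 0 := by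
  obtain ⟨a, b⟩ := x
  obtain ⟨c, d⟩ := y
  rw [Fintype.sum_option]
  simp only [slopeCoord, Prod.mk.injEq]
  by_cases hac : a = c
  · subst hac
    by_cases hbd : b = d <;> simp [hbd]
  · have : ∀ m, b + m * a = d + m * c ↔ m = (d - b) / (a - c) := fun m => by
      rw [eq_div_iff (sub_ne_zero.2 hac)]
      constructor <;> intro h <;> linear_combination h
    simp [hac, this]

theorem exists_isParallelFamily (V F : Type*) [AddGroup V] [Fintype V] [DecidableEq V] [Field F]
    [Fintype F] [DecidableEq F] (h : Fintype.card V = Fintype.card F + 2) :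
    ∃ π : V → F × F → F, IsParallelFamily π := by
  obtain ⟨e, he⟩ : ∃ e : V ≃ Option (Option F), e 0 = none := by
    let e₀ : V ≃ Option (Option F) := Fintype.equivOfCardEq (by simp [h])
    exact ⟨e₀.trans (Equiv.swap (e₀ 0) none), by simp⟩
  have he' : ∀ t, t ≠ 0 → ∃ s, e t = some s := fun t ht =>
    Option.ne_none_iff_exists'.1 fun hn => ht (e.injective (hn.trans he.symm))
  refine ⟨fun t => slopeCoord (e t), fun t u ht hu htu => ?_, fun x y => ?_⟩
  · obtain ⟨s, hs⟩ := he' t ht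
    obtain ⟨r, hr⟩ := he' u hu
    simp only [hs, hr]
    exact slopeCoord_bijective fun hsr => htu (e.injective (by rw [hs, hr, hsr]))
  · have h0 : ∀ s, e.symm (some s) ≠ 0 := fun s hs => by
      have := congrArg e hs
      simp [he] at this
    have h0' : e.symm none = 0 := by rw [← he, e.symm_apply_apply]
    rw [← sum_slopeCoord, ← e.symm.sum_comp, Fintype.sum_option]
    simp [h0, h0']

namespace IsOddSign

variable {V : Type*} [AddGroup V] {τ : V → ℤ}

theorem zero (hτ : IsOddSign τ) : τ 0 = 0 := by
  have := hτ.neg 0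
  rw [neg_zero] at this
  omega

theorem sum_eq_zero [Fintype V] (hτ : IsOddSign τ) : ∑ t, τ t = 0 := by
  have h := Equiv.sum_comp (Equiv.neg V) τ
  simp only [Equiv.neg_apply, hτ.neg, sum_neg_distrib] at h
  omega

theorem sq_eq [DecidableEq V] (hτ : IsOddSign τ) (t : V) : τ t ^ 2 = if t ≠ 0 then 1 else 0 := by
  by_cases ht : t = 0
  · simp [ht, hτ.zero]
  · simp [ht, hτ.sq t ht]

theorem sum_sq [Fintype V] [DecidableEq V] (hτ : IsOddSign τ) : ∑ t, τ t ^ 2 = Fintype.card V - 1 := by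
  have h : ∀ t, τ t ^ 2 = 1 - if t = 0 then 1 else 0 := fun t => by
    rw [hτ.sq_eq]; split_ifs <;> simp_all
  simp [h]

theorem cast_ne_zero (hτ : IsOddSign τ) {F : Type*} [Field F] {t : V} (ht : t ≠ 0) :
    (τ t : F) ≠ 0 := fun h => by
  have := congrArg (Int.cast : ℤ → F) (hτ.sq t ht)
  simp [h] at this

end IsOddSign

/-- The diagonal block: a signed sum of the incidence relations of the parallel classes. -/
def netBlock {V F : Type*} [Fintype V] [DecidableEq F] (τ : V → ℤ) (π : V → F × F → F)
    (x y : F × F) : ℤ :=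
  ∑ t, τ t * if π t x = π t y then 1 else 0

theorem netBlock_comm {V F : Type*} [Fintype V] [DecidableEq F] (τ : V → ℤ) (π : V → F × F → F)
    (x y : F × F) : netBlock τ π x y = netBlock τ π y x := by
  simp only [netBlock, eq_comm]

theorem netBlock_self {V F : Type*} [AddGroup V] [Fintype V] [DecidableEq F] {τ : V → ℤ}
    (hτ : IsOddSign τ) (π : V → F × F → F) (x : F × F) : netBlock τ π x x = 0 := by
  simp [netBlock, hτ.sum_eq_zero]

namespace IsParallelFamily

variable {V F : Type*} [AddGroup V] [Fintype V] [DecidableEq V] [Fintype F] [DecidableEq F]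
  {τ : V → ℤ} {π : V → F × F → F}

theorem sum_mul (hπ : IsParallelFamily π) {t u : V} (ht : t ≠ 0) (hu : u ≠ 0) (htu : t ≠ u)
    (f g : F → ℤ) : ∑ z, f (π t z) * g (π u z) = (∑ a, f a) * ∑ b, g b := by
  rw [sum_mul_sum, ← Fintype.sum_prod_type']
  exact (Equiv.ofBijective _ (hπ.bijective t u ht hu htu)).sum_comp fun p => f p.1 * g p.2

theorem sum_comp (hV : ∀ t : V, t ≠ 0 → -t ≠ t) (hπ : IsParallelFamily π) {t : V} (ht : t ≠ 0)
    (f : F → ℤ) : ∑ z, f (π t z) = Fintype.card F * ∑ a, f a := by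
  have h := hπ.sum_mul ht (neg_ne_zero.2 ht) (hV t ht).symm f 1
  simp only [Pi.one_apply, mul_one, sum_const, card_univ, nsmul_eq_mul] at h
  rw [h, mul_comm]

theorem sum_netBlock_mul (hV : ∀ t : V, t ≠ 0 → -t ≠ t) (hτ : IsOddSign τ) (hπ : IsParallelFamily π)
    {t : V} (ht : t ≠ 0) (g : F → ℤ) (x : F × F) :
    ∑ z, netBlock τ π x z * g (π t z) = τ t * (Fintype.card F * g (π t x) - ∑ a, g a) := by
  have key : ∀ u, ∑ z, (τ u * if π u x = π u z then 1 else 0) * g (π t z) =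
      τ u * (∑ a, g a) + if u = t then τ t * (Fintype.card F * g (π t x) - ∑ a, g a) else 0 := by
    intro u
    by_cases hu : u = 0
    · subst hu; simp [hτ.zero, Ne.symm ht]
    by_cases hut : u = t
    · subst hut
      have := sum_comp hV hπ hu fun a => (τ u * if π u x = a then 1 else 0) * g a
      rw [this]
      simp
      ring
    · have := hπ.sum_mul hu ht hut (fun a => τ u * if π u x = a then 1 else 0) g
      rw [this]
      simp [hut]
  simp only [netBlock, Finset.sum_mul]
  rw [sum_comm]
  simp only [key, sum_add_distrib, ← Finset.sum_mul, hτ.sum_eq_zero]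
  simp

theorem sum_sq_mul (hτ : IsOddSign τ) (hπ : IsParallelFamily π) (x y : F × F) :
    ∑ t, τ t ^ 2 * (if π t x = π t y then 1 else 0) =
      1 + (Fintype.card F : ℤ) * (if x = y then 1 else 0) := by
  rw [← hπ.sum_eq]
  refine sum_congr rfl fun t _ => ?_
  rw [hτ.sq_eq]
  split_ifs <;> simp_all

theorem sum_netBlock_mul_netBlock (hV : ∀ t : V, t ≠ 0 → -t ≠ t)
    (hVF : Fintype.card V = Fintype.card F + 2) (hτ : IsOddSign τ)
    (hπ : IsParallelFamily π) (x y : F × F) :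
    ∑ z, netBlock τ π x z * netBlock τ π z y =
      Fintype.card F ^ 2 * (if x = y then 1 else 0) - 1 := by
  have key : ∀ t, ∑ z, netBlock τ π x z * (τ t * if π t z = π t y then 1 else 0) =
      Fintype.card F * (τ t ^ 2 * if π t x = π t y then 1 else 0) - τ t ^ 2 := by
    intro t
    by_cases ht : t = 0
    · subst ht; simp [hτ.zero]
    · have := sum_netBlock_mul hV hτ hπ ht (fun a => τ t * if a = π t y then 1 else 0) x
      rw [this, ← Finset.mul_sum]
      simp only [sum_ite_eq', mem_univ, if_true]
      ring
  conv_lhs =>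
    enter [2, z, 2]
    rw [netBlock]
  simp only [Finset.mul_sum]
  rw [sum_comm]
  simp only [key, sum_sub_distrib, ← Finset.mul_sum, hπ.sum_sq_mul hτ, hτ.sum_sq, hVF]
  push_cast
  ring

theorem netBlock_eq (hτ : IsOddSign τ) (hπ : IsParallelFamily π) {x y : F × F} (hxy : x ≠ y) :
    netBlock τ π x y = 1 ∨ netBlock τ π x y = -1 := by
  have h := hπ.sum_eq x y
  rw [if_neg hxy, mul_zero, add_zero, sum_boole, Nat.cast_eq_one, card_eq_one] at h
  obtain ⟨t, ht⟩ := h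
  have ht' : ∀ u, (u ≠ 0 ∧ π u x = π u y) ↔ u = t := fun u => by
    simpa using congrArg (u ∈ ·) ht
  have : netBlock τ π x y = τ t := by
    rw [netBlock, sum_eq_single t]
    · simp [((ht' t).2 rfl).2]
    · intro u _ hut
      by_cases hu : u = 0
      · simp [hu, hτ.zero]
      · rw [if_neg fun h => hut ((ht' u).1 ⟨hu, h⟩), mul_zero]
    · simp
  rw [this]
  exact sq_eq_one_iff.1 (hτ.sq t ((ht' t).2 rfl).1)

end IsParallelFamily

/-! ### The symmetric core -/

/-- The symmetric matrix with blocks indexed by `V`, whose diagonal blocks are `netBlock` and whose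
off-diagonal blocks are translates of `quadraticSign F`, signed by the quadratic character. -/
def mathonCore {V F : Type*} [Field V] [Fintype V] [DecidableEq V] [Field F] [Fintype F]
    [DecidableEq F] (τ : V → ℤ) (π : V → F × F → F) : Matrix (V × F × F) (V × F × F) ℤ :=
  fun a b => if a.1 = b.1 then netBlock τ π a.2 b.2 else
    quadraticChar V (a.1 - b.1) *
      quadraticSign F (τ (a.1 - b.1) * (π (b.1 - a.1) a.2 - π (a.1 - b.1) b.2))

section mathonCore

variable {V F : Type*} [Field V] [Fintype V] [DecidableEq V] [Field F] [Fintype F]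
  [DecidableEq F] {τ : V → ℤ} {π : V → F × F → F}

theorem mathonCore_transpose (hτ : IsOddSign τ) (hV1 : quadraticChar V (-1) = 1) :
    (mathonCore τ π).transpose = mathonCore τ π := by
  ext ⟨i, x⟩ ⟨j, y⟩
  simp only [Matrix.transpose_apply, mathonCore]
  by_cases hij : i = j
  · subst hij; simp [netBlock_comm]
  · rw [if_neg hij, if_neg (Ne.symm hij), ← neg_sub i j, hτ.neg, ← neg_one_mul (i - j), map_mul,
      hV1, one_mul]
    congr 2
    push_cast
    ring

theorem mathonCore_self (hτ : IsOddSign τ) (a : V × F × F) : mathonCore τ π a a = 0 := by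
  simp [mathonCore, netBlock_self hτ]

theorem mathonCore_eq (hτ : IsOddSign τ) (hπ : IsParallelFamily π) {a b : V × F × F}
    (hab : a ≠ b) : mathonCore τ π a b = 1 ∨ mathonCore τ π a b = -1 := by
  obtain ⟨i, x⟩ := a
  obtain ⟨j, y⟩ := b
  by_cases hij : i = j
  · subst hij
    simpa [mathonCore] using hπ.netBlock_eq hτ (x := x) (y := y) fun h => hab (by rw [h])
  · simp only [mathonCore, if_neg hij]
    rcases quadraticChar_dichotomy (sub_ne_zero.2 hij) with h | h <;>
    rcases quadraticSign_eq ((τ (i - j) : F) * (π (j - i) x - π (i - j) y)) with h' | h' <;>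
    simp [h, h']

theorem sum_mathonCore_block_self (hV : ringChar V ≠ 2) (hF : ringChar F ≠ 2)
    (hF1 : quadraticChar F (-1) = -1) (hV1 : quadraticChar V (-1) = 1)
    (hVF : Fintype.card V = Fintype.card F + 2) (hτ : IsOddSign τ) (hπ : IsParallelFamily π)
    (i k : V) (x y : F × F) :
    ∑ z, mathonCore τ π (i, x) (k, z) * mathonCore τ π (k, z) (i, y) =
      (if k = i then (Fintype.card F : ℤ) ^ 2 * (if x = y then 1 else 0) - 1 else 0) +
        Fintype.card F * ((Fintype.card F + 1) *
          (τ (k - i) ^ 2 * if π (k - i) x = π (k - i) y then 1 else 0) - τ (k - i) ^ 2) := by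
  have hV' : ∀ t : V, t ≠ 0 → -t ≠ t := fun t => neg_ne_self_of_ringChar_ne_two hV
  by_cases hik : k = i
  · subst hik
    simp [mathonCore, hπ.sum_netBlock_mul_netBlock hV' hVF hτ, hτ.zero]
  · have h0 : i - k ≠ 0 := sub_ne_zero.2 (Ne.symm hik)
    have hterm : ∀ z, mathonCore τ π (i, x) (k, z) * mathonCore τ π (k, z) (i, y) =
        quadraticSign F (τ (i - k) * (π (k - i) x - π (i - k) z)) *
          quadraticSign F (τ (i - k) * (π (k - i) y - π (i - k) z)) := fun z => by
      have hs : mathonCore τ π (k, z) (i, y) = mathonCore τ π (i, y) (k, z) :=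
        congrFun (congrFun (mathonCore_transpose hτ hV1) (i, y)) (k, z)
      rw [hs]
      simp only [mathonCore, if_neg (Ne.symm hik)]
      have := quadraticChar_sq_one h0
      linear_combination (quadraticSign F (τ (i - k) * (π (k - i) x - π (i - k) z)) *
          quadraticSign F (τ (i - k) * (π (k - i) y - π (i - k) z))) * this
    simp only [hterm]
    have h1 := hπ.sum_comp hV' h0 fun a => quadraticSign F (τ (i - k) * (π (k - i) x - a)) *
          quadraticSign F (τ (i - k) * (π (k - i) y - a))
    rw [h1, sum_quadraticSign_mul_scaled hF hF1 (hτ.cast_ne_zero h0), if_neg hik,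
      hτ.sq _ (sub_ne_zero.2 hik)]
    ring

theorem sum_mathonCore_block_of_ne (hV : ringChar V ≠ 2) (hF : ringChar F ≠ 2)
    (hτ : IsOddSign τ) (hπ : IsParallelFamily π) {i j : V} (hij : i ≠ j) (k : V) (x y : F × F) :
    ∑ z, mathonCore τ π (i, x) (k, z) * mathonCore τ π (k, z) (j, y) =
      quadraticChar V (i - k) * quadraticChar V (k - j) +
        ((if k = i then 1 else 0) - if k = j then 1 else 0) *
          (quadraticChar V (i - j) * τ (j - i) * (Fintype.card F *
            quadraticSign F (τ (i - j) * (π (j - i) x - π (i - j) y)) - 1)) := by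
  have hV' : ∀ t : V, t ≠ 0 → -t ≠ t := fun t => neg_ne_self_of_ringChar_ne_two hV
  have h0 : i - j ≠ 0 := sub_ne_zero.2 hij
  have h0' : j - i ≠ 0 := sub_ne_zero.2 (Ne.symm hij)
  by_cases hki : k = i
  · subst hki
    have h1 := hπ.sum_netBlock_mul hV' hτ h0'
      (fun a => quadraticSign F (τ (k - j) * (a - π (k - j) y))) x
    rw [sum_quadraticSign_mul_left hF (hτ.cast_ne_zero h0)] at h1
    simp only [mathonCore, if_true, if_neg hij, mul_left_comm _ (quadraticChar V (k - j)),
      ← Finset.mul_sum, h1, sub_self, MulChar.map_zero]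
    ring
  by_cases hkj : k = j
  · subst hkj
    have h1 := hπ.sum_netBlock_mul hV' hτ h0
      (fun a => quadraticSign F (τ (i - k) * (π (k - i) x - a))) y
    rw [sum_quadraticSign_mul_left' hF (hτ.cast_ne_zero h0)] at h1
    simp only [mathonCore, if_true, if_neg hij, mul_assoc, netBlock_comm τ π _ y,
      ← Finset.mul_sum, mul_comm (quadraticSign F _) (netBlock τ π _ _), h1, sub_self,
      MulChar.map_zero, if_neg hki]
    rw [← neg_sub i k, hτ.neg]
    ring
  · have h1 : i - k ≠ 0 := sub_ne_zero.2 (Ne.symm hki)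
    have h2 : j - k ≠ 0 := sub_ne_zero.2 (Ne.symm hkj)
    have h3 : k - j ≠ 0 := sub_ne_zero.2 hkj
    have h4 := hπ.sum_mul h1 h2 (fun h => hij (sub_left_injective h))
      (fun a => quadraticSign F (τ (i - k) * (π (k - i) x - a)))
      (fun a => quadraticSign F (τ (k - j) * (a - π (k - j) y)))
    rw [sum_quadraticSign_mul_left' hF (hτ.cast_ne_zero h1),
      sum_quadraticSign_mul_left hF (hτ.cast_ne_zero h3)] at h4
    simp only [mathonCore, if_neg (Ne.symm hki), if_neg hki, if_neg hkj]
    rw [sum_congr rfl fun z _ => mul_mul_mul_comm _ _ _ _, ← Finset.mul_sum, h4]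
    ring

theorem mathonCore_mul_self (hV : ringChar V ≠ 2) (hF : ringChar F ≠ 2)
    (hF1 : quadraticChar F (-1) = -1) (hV1 : quadraticChar V (-1) = 1)
    (hVF : Fintype.card V = Fintype.card F + 2) (hτ : IsOddSign τ) (hπ : IsParallelFamily π)
    (a b : V × F × F) :
    ∑ c, mathonCore τ π a c * mathonCore τ π c b =
      Fintype.card (V × F × F) * (if a = b then 1 else 0) - 1 := by
  obtain ⟨i, x⟩ := a
  obtain ⟨j, y⟩ := b
  rw [Fintype.sum_prod_type]
  by_cases hij : i = j
  · subst hij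
    have h1 := Equiv.sum_comp (Equiv.subRight i) fun t => τ t ^ 2
    have h2 := Equiv.sum_comp (Equiv.subRight i) fun t =>
      τ t ^ 2 * if π t x = π t y then (1 : ℤ) else 0
    simp only [Equiv.subRight_apply] at h1 h2
    simp only [sum_mathonCore_block_self hV hF hF1 hV1 hVF hτ hπ, sum_add_distrib,
      ← Finset.mul_sum, sum_sub_distrib, h1, h2, hτ.sum_sq, hπ.sum_sq_mul hτ, sum_ite_eq',
      mem_univ, if_true, hVF, Fintype.card_prod, Prod.mk.injEq, true_and]
    push_cast
    ring
  · have h1 : ∑ k, quadraticChar V (i - k) * quadraticChar V (k - j) = -1 := by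
      rw [← hV1, ← quadraticChar_sum_mul_sub hV (sub_ne_zero.2 hij),
        ← Equiv.sum_comp (Equiv.subLeft i)]
      refine sum_congr rfl fun k _ => ?_
      simp only [Equiv.subLeft_apply]
      congr 2 <;> ring
    simp only [sum_mathonCore_block_of_ne hV hF hτ hπ hij, sum_add_distrib, h1, ← Finset.sum_mul]
    simp [hij]

end mathonCore

/-! ### Bordering and doubling -/

/-- The conference matrix obtained from a core by adding a border of ones. -/
def borderedMatrix {α : Type*} (S : Matrix α α ℤ) : Matrix (Option α) (Option α) ℤ
  | none, none => 0
  | none, some _ => 1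
  | some _, none => 1
  | some a, some b => S a b

theorem sum_row_eq_zero {α : Type*} [Fintype α] [DecidableEq α] {S : Matrix α α ℤ}
    (hS : S.transpose = S)
    (h : ∀ a b, ∑ c, S a c * S c b = Fintype.card α * (if a = b then 1 else 0) - 1) (a : α) :
    ∑ b, S a b = 0 := by
  have hs : ∀ a b, S a b = S b a := fun a b => congrFun (congrFun hS b) a
  have h1 : ∑ c, (∑ b, S c b) ^ 2 = 0 := by
    calc ∑ c, (∑ b, S c b) ^ 2 = ∑ c, ∑ a, ∑ b, S a c * S c b := by
          refine sum_congr rfl fun c _ => ?_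
          rw [sq, sum_mul_sum]
          exact sum_congr rfl fun a _ => sum_congr rfl fun b _ => by rw [hs c a]
      _ = ∑ a, ∑ b, ∑ c, S a c * S c b := by
          rw [sum_comm]
          exact sum_congr rfl fun a _ => sum_comm
      _ = 0 := by simp [h]
  have := (sum_eq_zero_iff_of_nonneg fun c _ => sq_nonneg (∑ b, S c b)).1 h1 a (mem_univ a)
  exact pow_eq_zero_iff two_ne_zero |>.1 this

theorem borderedMatrix_transpose {α : Type*} {S : Matrix α α ℤ} (hS : S.transpose = S) :
    (borderedMatrix S).transpose = borderedMatrix S := by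
  ext a b
  rcases a with _ | a <;> rcases b with _ | b <;> try rfl
  exact congrFun (congrFun hS a) b

theorem borderedMatrix_mul_self {α : Type*} [Fintype α] [DecidableEq α] {S : Matrix α α ℤ}
    (hS : S.transpose = S)
    (h : ∀ a b, ∑ c, S a c * S c b = Fintype.card α * (if a = b then 1 else 0) - 1) :
    borderedMatrix S * borderedMatrix S = (Fintype.card α : ℤ) • 1 := by
  have hr := sum_row_eq_zero hS h
  have hc : ∀ b, ∑ a, S a b = 0 := fun b => by
    rw [← hr b]
    exact sum_congr rfl fun a _ => congrFun (congrFun hS b) a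
  ext a b
  rw [Matrix.mul_apply, Fintype.sum_option]
  rcases a with _ | a <;> rcases b with _ | b <;>
    simp [borderedMatrix, hr, hc, h, Matrix.one_apply]

/-- The doubling of a conference matrix. -/
def doubledMatrix {α : Type*} [DecidableEq α] (C : Matrix α α ℤ) : Matrix (α ⊕ α) (α ⊕ α) ℤ :=
  Matrix.fromBlocks (C + 1) (C - 1) (C - 1) (-C - 1)

theorem doubledMatrix_transpose {α : Type*} [DecidableEq α] {C : Matrix α α ℤ}
    (hC : C.transpose = C) : (doubledMatrix C).transpose = doubledMatrix C := by
  simp [doubledMatrix, Matrix.fromBlocks_transpose, hC]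

theorem doubledMatrix_mul_self {α : Type*} [Fintype α] [DecidableEq α] {C : Matrix α α ℤ} {m : ℤ}
    (h : C * C = m • 1) : doubledMatrix C * doubledMatrix C = (2 * m + 2) • 1 := by
  have h1 : (C + 1) * (C + 1) + (C - 1) * (C - 1) = (2 * m + 2) • 1 := by
    calc _ = (2 : ℤ) • (C * C) + (2 : ℤ) • 1 := by noncomm_ring
      _ = _ := by rw [h, smul_smul, ← add_smul]
  rw [doubledMatrix, Matrix.fromBlocks_multiply, ← Matrix.fromBlocks_one, Matrix.fromBlocks_smul]
  congr 1
  · rw [smul_zero]; noncomm_ring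
  · rw [smul_zero]; noncomm_ring
  · rw [← h1]; noncomm_ring

theorem doubledMatrix_eq {α : Type*} [DecidableEq α] {C : Matrix α α ℤ} (h0 : ∀ i, C i i = 0)
    (h1 : ∀ i j, i ≠ j → C i j = 1 ∨ C i j = -1) (i j : α ⊕ α) :
    doubledMatrix C i j = 1 ∨ doubledMatrix C i j = -1 := by
  rcases i with i | i <;> rcases j with j | j <;> by_cases hij : i = j <;>
    simp [doubledMatrix, hij, h0]
  all_goals
    have := h1 i j hij
    omega

theorem exists_isConference_fin {α : Type*} [Fintype α] [DecidableEq α] {n : ℕ}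
    (hn : Fintype.card α = n) {C : Matrix α α ℤ} (hC : C.transpose = C) (h0 : ∀ i, C i i = 0)
    (h1 : ∀ i j, i ≠ j → C i j = 1 ∨ C i j = -1) (h : C * C = ((n : ℤ) - 1) • 1) :
    ∃ C : Matrix (Fin n) (Fin n) ℤ, IsConference n C ∧ C.transpose = C := by
  let e : Fin n ≃ α := (Fintype.equivFinOfCardEq hn).symm
  have ht : (C.submatrix e e).transpose = C.submatrix e e := by rw [Matrix.transpose_submatrix, hC]
  refine ⟨C.submatrix e e, ⟨fun i => h0 _, fun i j hij => h1 _ _ (e.injective.ne hij), ?_⟩, ht⟩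
  rw [ht, Matrix.submatrix_mul_equiv, h, Matrix.submatrix_smul]
  simp only [Pi.smul_apply, Matrix.submatrix_one_equiv]

theorem exists_isHadamard_fin {α : Type*} [Fintype α] [DecidableEq α] {n : ℕ}
    (hn : Fintype.card α = n) {H : Matrix α α ℤ} (hH : H.transpose = H)
    (h1 : ∀ i j, H i j = 1 ∨ H i j = -1) (h : H * H = (n : ℤ) • 1) :
    ∃ H : Matrix (Fin n) (Fin n) ℤ, IsHadamard n H ∧ H.transpose = H := by
  let e : Fin n ≃ α := (Fintype.equivFinOfCardEq hn).symm
  have ht : (H.submatrix e e).transpose = H.submatrix e e := by rw [Matrix.transpose_submatrix, hH]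
  refine ⟨H.submatrix e e, ⟨fun i j => h1 _ _, ?_⟩, ht⟩
  rw [ht, Matrix.submatrix_mul_equiv, h, Matrix.submatrix_smul]
  simp only [Pi.smul_apply, Matrix.submatrix_one_equiv]

theorem exists_symmetric_core (V F : Type*) [Field V] [Fintype V] [DecidableEq V] [Field F]
    [Fintype F] [DecidableEq F] (hF : Fintype.card F % 4 = 3)
    (hVF : Fintype.card V = Fintype.card F + 2) :
    ∃ S : Matrix (V × F × F) (V × F × F) ℤ, S.transpose = S ∧ (∀ a, S a a = 0) ∧
      (∀ a b, a ≠ b → S a b = 1 ∨ S a b = -1) ∧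
      ∀ a b, ∑ c, S a c * S c b = Fintype.card (V × F × F) * (if a = b then 1 else 0) - 1 := by
  have hF2 : ringChar F ≠ 2 := fun h => by
    have := FiniteField.even_card_iff_char_two.1 h
    omega
  have hV2 : ringChar V ≠ 2 := fun h => by
    have := FiniteField.even_card_iff_char_two.1 h
    omega
  have hF1 : quadraticChar F (-1) = -1 := by
    rw [quadraticChar_neg_one hF2, ZMod.χ₄_nat_three_mod_four hF]
  have hV1 : quadraticChar V (-1) = 1 := by
    rw [quadraticChar_neg_one hV2, ZMod.χ₄_nat_one_mod_four (by omega)]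
  obtain ⟨τ, hτ⟩ := exists_isOddSign V hV2
  obtain ⟨π, hπ⟩ := exists_isParallelFamily V F hVF
  exact ⟨mathonCore τ π, mathonCore_transpose hτ hV1, mathonCore_self hτ,
    fun _ _ => mathonCore_eq hτ hπ, mathonCore_mul_self hV2 hF2 hF1 hV1 hVF hτ hπ⟩

theorem mathon_conference (q : ℕ) (hq : IsPrimePow q) (hq3 : q % 4 = 3)
    (hq2 : IsPrimePow (q + 2)) :
    (∃ C : Matrix (Fin (q ^ 2 * (q + 2) + 1)) (Fin (q ^ 2 * (q + 2) + 1)) ℤ,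
        IsConference (q ^ 2 * (q + 2) + 1) C ∧ C.transpose = C) ∧
    (∃ H : Matrix (Fin (2 * q ^ 2 * (q + 2) + 2)) (Fin (2 * q ^ 2 * (q + 2) + 2)) ℤ,
        IsHadamard (2 * q ^ 2 * (q + 2) + 2) H ∧ H.transpose = H) := by
  obtain ⟨F, hF, hFc⟩ : ∃ (F : Type) (_ : Field F), Nat.card F = q := by
    rw [← Fintype.card_fin q, Fintype.nonempty_field_iff.symm] at hq
    exact ⟨Fin q, hq.some, by simp⟩
  obtain ⟨V, hV, hVc⟩ : ∃ (V : Type) (_ : Field V), Nat.card V = q + 2 := by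
    rw [← Fintype.card_fin (q + 2), Fintype.nonempty_field_iff.symm] at hq2
    exact ⟨Fin (q + 2), hq2.some, by simp⟩
  classical
  have : Finite F := Nat.finite_of_card_ne_zero (by omega)
  have : Finite V := Nat.finite_of_card_ne_zero (by omega)
  have := Fintype.ofFinite F
  have := Fintype.ofFinite V
  rw [Nat.card_eq_fintype_card] at hFc hVc
  obtain ⟨S, hS, hS0, hS1, hSS⟩ := exists_symmetric_core V F (by omega) (by omega)
  have hcard : Fintype.card (V × F × F) = q ^ 2 * (q + 2) := by
    rw [Fintype.card_prod, Fintype.card_prod, hFc, hVc]; ring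
  have hC := borderedMatrix_transpose hS
  have hCC := borderedMatrix_mul_self hS hSS
  have hC0 : ∀ a, borderedMatrix S a a = 0 := by rintro (_ | a); exacts [rfl, hS0 a]
  have hC1 : ∀ a b, a ≠ b → borderedMatrix S a b = 1 ∨ borderedMatrix S a b = -1 := by
    rintro (_ | a) (_ | b) hab
    exacts [absurd rfl hab, .inl rfl, .inl rfl, hS1 a b fun h => hab (by rw [h])]
  refine ⟨exists_isConference_fin (by simp [hFc, hVc]; ring) hC hC0 hC1 ?_,
    exists_isHadamard_fin ?_ (doubledMatrix_transpose hC) (doubledMatrix_eq hC0 hC1) ?_⟩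
  · rw [hCC, hcard]; push_cast; ring_nf
  · rw [Fintype.card_sum, Fintype.card_option, hcard]; ring
  · rw [doubledMatrix_mul_self hCC, hcard]; push_cast; ring_nf
end

section
/- Let q ≡ 1 (mod 8) be a prime power. If there exists a Hadamard matrix of order (q−1)/2, then there exists a Hadamard matrix of order 4q. -/
open Matrix hiding IsHadamard

open scoped Kronecker

section QuadraticCharacter

variable {F : Type*} [Field F] [Fintype F] [DecidableEq F]

theorem sum_units_eq_sub (f : F → ℤ) : ∑ u : Fˣ, f u = ∑ y, f y - f 0 := by
  have h : ∑ u : Fˣ, f u = ∑ y : {y : F // y ≠ 0}, f y :=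
    Fintype.sum_equiv unitsEquivNeZero _ _ fun _ => rfl
  have h' : ∑ y : {y : F // y ≠ 0}, f y = ∑ y ∈ Finset.univ.erase 0, f y :=
    (Finset.sum_subtype _ (by simp) f).symm
  rw [h, h', ← Finset.add_sum_erase Finset.univ f (Finset.mem_univ 0)]
  ring

theorem quadraticChar_units_mul_self (x : Fˣ) :
    quadraticChar F x * quadraticChar F x = 1 := by
  rw [← sq]
  exact quadraticChar_sq_one x.ne_zero

theorem sum_quadraticChar_sub_mul_sub (hF : ringChar F ≠ 2) (hneg : quadraticChar F (-1) = 1)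
    (x z : F) :
    ∑ y, quadraticChar F (x - y) * quadraticChar F (z - y) =
      (if x = z then (Fintype.card F : ℤ) else 0) - 1 := by
  split_ifs with h
  · subst h
    have hsub := (Equiv.subLeft x).sum_comp fun t => quadraticChar F t * quadraticChar F t
    simp only [Equiv.subLeft_apply] at hsub
    have hunits := sum_units_eq_sub fun t : F => quadraticChar F t * quadraticChar F t
    simp only [quadraticChar_units_mul_self] at hunits
    rw [hsub]
    have hcard := Fintype.card_units F
    have hpos : 0 < Fintype.card F := Fintype.card_pos
    simp only [Finset.sum_const, Finset.card_univ, MulChar.map_zero] at hunits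
    simp only [nsmul_eq_mul, mul_one, mul_zero, sub_zero] at hunits
    omega
  · have hd : z - x ≠ 0 := sub_ne_zero.mpr (Ne.symm h)
    have hsub := ((Equiv.mulLeft₀ (z - x) hd).trans (Equiv.addLeft x)).sum_comp
      fun y => quadraticChar F (x - y) * quadraticChar F (z - y)
    have hjac := jacobiSum_nontrivial_inv (quadraticChar_ne_one hF)
    rw [(quadraticChar_isQuadratic F).inv, hneg] at hjac
    rw [← hsub, zero_sub, ← hjac, jacobiSum]
    refine Finset.sum_congr rfl fun r _ => ?_
    have h₁ : x - (x + (z - x) * r) = -1 * ((z - x) * r) := by ring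
    have h₂ : z - (x + (z - x) * r) = (z - x) * (1 - r) := by ring
    simp only [Equiv.trans_apply, Equiv.mulLeft₀_apply, Equiv.coe_addLeft]
    rw [h₁, h₂, map_mul, map_mul, map_mul, hneg]
    linear_combination
      (quadraticChar F r * quadraticChar F (1 - r)) * quadraticChar_sq_one hd

theorem sum_units_quadraticChar (hF : ringChar F ≠ 2) :
    ∑ u : Fˣ, quadraticChar F u = 0 := by
  rw [sum_units_eq_sub, quadraticChar_sum_zero hF, MulChar.map_zero, sub_zero]

theorem sum_units_quadraticChar_sub (hF : ringChar F ≠ 2) (x : Fˣ) :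
    ∑ y : Fˣ, quadraticChar F (x - y) = -quadraticChar F x := by
  rw [sum_units_eq_sub fun y : F => quadraticChar F (x - y), sub_zero]
  have h := (Equiv.subLeft (x : F)).sum_comp fun t => quadraticChar F t
  simp only [Equiv.subLeft_apply] at h
  rw [h, quadraticChar_sum_zero hF, zero_sub]

theorem sum_units_quadraticChar_sub_mul (hF : ringChar F ≠ 2) (hneg : quadraticChar F (-1) = 1)
    (x : Fˣ) : ∑ y : Fˣ, quadraticChar F (x - y) * quadraticChar F y = -1 := by
  have h := sum_quadraticChar_sub_mul_sub hF hneg (x : F) 0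
  rw [if_neg x.ne_zero, zero_sub] at h
  rw [sum_units_eq_sub fun y : F => quadraticChar F (x - y) * quadraticChar F y,
    MulChar.map_zero, mul_zero, sub_zero, ← h]
  refine Finset.sum_congr rfl fun y _ => ?_
  rw [zero_sub, neg_eq_neg_one_mul y, map_mul, hneg, one_mul]

/-- The Paley matrix restricted to the nonzero elements, with rows rescaled. -/
def punctured_paley (F : Type*) [Field F] [Fintype F] [DecidableEq F] : Matrix Fˣ Fˣ ℤ :=
  of fun x y => quadraticChar F x * quadraticChar F (x - y)

/-- The incidence matrix of nonzero elements with the two quadratic residue classes. -/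
def residue_class (F : Type*) [Field F] [Fintype F] [DecidableEq F] : Matrix Fˣ (Fin 2) ℤ :=
  of fun x k => if quadraticChar F x = ![1, -1] k then 1 else 0

theorem two_mul_residue_class (x : Fˣ) (k : Fin 2) :
    2 * residue_class F x k = 1 + ![1, -1] k * quadraticChar F x := by
  rcases quadraticChar_dichotomy x.ne_zero with h | h <;> fin_cases k <;>
    simp [residue_class, h, -quadraticChar_apply]

theorem exists_residue_class_eq (x : Fˣ) :
    ∃ k, ∀ l, residue_class F x l = if k = l then 1 else 0 := by
  rcases quadraticChar_dichotomy x.ne_zero with h | h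
  · exact ⟨0, fun l => by fin_cases l <;> simp [residue_class, h, -quadraticChar_apply]⟩
  · exact ⟨1, fun l => by fin_cases l <;> simp [residue_class, h, -quadraticChar_apply]⟩

theorem residue_class_transpose_mul_self (hF : ringChar F ≠ 2) :
    2 • ((residue_class F)ᵀ * residue_class F) = ((Fintype.card F : ℤ) - 1) • 1 := by
  ext k l
  have hcard := Fintype.card_units F
  have hpos : 0 < Fintype.card F := Fintype.card_pos
  have h : 4 * ((residue_class F)ᵀ * residue_class F) k l =
      (1 + ![1, -1] k * ![1, -1] l) * ((Fintype.card F : ℤ) - 1) := by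
    rw [mul_apply, Finset.mul_sum]
    calc
      _ = ∑ x : Fˣ, ((1 + ![1, -1] k * ![1, -1] l) +
            (![1, -1] k + ![1, -1] l) * quadraticChar F x) :=
        Finset.sum_congr rfl fun x _ => by
          rw [transpose_apply]
          linear_combination (2 * residue_class F x l) * two_mul_residue_class x k +
            (1 + ![1, -1] k * quadraticChar F x) * two_mul_residue_class x l +
            (![1, -1] k * ![1, -1] l) * quadraticChar_units_mul_self x
      _ = _ := by
        rw [Finset.sum_add_distrib, ← Finset.mul_sum, sum_units_quadraticChar hF]
        simp only [Finset.sum_const, Finset.card_univ, hcard, nsmul_eq_mul]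
        push_cast [Nat.cast_sub (show 1 ≤ Fintype.card F from hpos)]
        ring
  rw [Matrix.smul_apply, Matrix.smul_apply, one_apply, nsmul_eq_mul, smul_eq_mul]
  fin_cases k <;> fin_cases l <;> simp at h ⊢ <;> linarith

theorem punctured_paley_mul_residue_class (hF : ringChar F ≠ 2)
    (hneg : quadraticChar F (-1) = 1) :
    punctured_paley F * residue_class F = -residue_class F := by
  ext x k
  have h : 2 * (punctured_paley F * residue_class F) x k = -(2 * residue_class F x k) := by
    rw [mul_apply, Finset.mul_sum]
    calc
      _ = ∑ y : Fˣ, (quadraticChar F x * quadraticChar F (x - y) +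
            (quadraticChar F x * ![1, -1] k) *
              (quadraticChar F (x - y) * quadraticChar F y)) :=
        Finset.sum_congr rfl fun y _ => by
          rw [punctured_paley, of_apply]
          linear_combination (quadraticChar F x * quadraticChar F (x - y)) *
            two_mul_residue_class y k
      _ = _ := by
        rw [Finset.sum_add_distrib, ← Finset.mul_sum, ← Finset.mul_sum,
          sum_units_quadraticChar_sub hF, sum_units_quadraticChar_sub_mul hF hneg,
          two_mul_residue_class]
        linear_combination -quadraticChar_units_mul_self x
  rw [neg_apply]
  linarith

theorem punctured_paley_mul_transpose (hF : ringChar F ≠ 2)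
    (hneg : quadraticChar F (-1) = 1) :
    punctured_paley F * (punctured_paley F)ᵀ =
      (Fintype.card F : ℤ) • 1 - 2 • (residue_class F * (residue_class F)ᵀ) := by
  ext x z
  have hclass : 2 * (residue_class F * (residue_class F)ᵀ) x z =
      1 + quadraticChar F x * quadraticChar F z := by
    rw [mul_apply, Fin.sum_univ_two]
    rcases quadraticChar_dichotomy x.ne_zero with h | h <;>
      rcases quadraticChar_dichotomy z.ne_zero with h' | h' <;> simp [residue_class, h, h', -quadraticChar_apply]
  have hsum := sum_units_eq_sub fun y : F => quadraticChar F (x - y) * quadraticChar F (z - y)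
  rw [sum_quadraticChar_sub_mul_sub hF hneg, sub_zero, sub_zero] at hsum
  rw [Matrix.sub_apply, Matrix.smul_apply, Matrix.smul_apply, one_apply, nsmul_eq_mul,
    smul_eq_mul, Nat.cast_ofNat, hclass, mul_apply]
  have hpull : ∑ y, punctured_paley F x y * (punctured_paley F)ᵀ y z =
      quadraticChar F x * quadraticChar F z *
        ∑ y : Fˣ, quadraticChar F (x - y) * quadraticChar F (z - y) := by
    rw [Finset.mul_sum]
    refine Finset.sum_congr rfl fun y _ => ?_
    simp only [punctured_paley, transpose_apply, of_apply]
    ring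
  rw [hpull, hsum]
  by_cases hxz : x = z
  · subst hxz
    rw [if_pos rfl, if_pos rfl]
    linear_combination
      (Fintype.card F - 2 - quadraticChar F x * quadraticChar F x + 1) *
        quadraticChar_units_mul_self x
  · rw [if_neg hxz, if_neg fun h => hxz (Units.ext h)]
    linear_combination -quadraticChar F z * quadraticChar F z * quadraticChar_units_mul_self x -
      quadraticChar_units_mul_self z

theorem punctured_paley_apply_self (x : Fˣ) : punctured_paley F x x = 0 := by
  simp [punctured_paley]

theorem punctured_paley_apply_of_ne {x y : Fˣ} (h : x ≠ y) :
    punctured_paley F x y = 1 ∨ punctured_paley F x y = -1 := by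
  have hsub : (x : F) - y ≠ 0 := sub_ne_zero.mpr fun h' => h (Units.ext h')
  rcases quadraticChar_dichotomy x.ne_zero with hx | hx <;>
    rcases quadraticChar_dichotomy hsub with hy | hy <;>
      simp [punctured_paley, hx, hy, -quadraticChar_apply]

end QuadraticCharacter

section Bordering

variable {ι κ : Type*} [Fintype κ] [DecidableEq κ]

/-- Miyamoto's bordered array built from matrices `U`, `V` on `ι` and a border indexed by `κ`. -/
def miyamoto_array (U V : Matrix ι ι ℤ) (P : Matrix ι κ ℤ) (X Y Z : Matrix κ κ ℤ) :
    Matrix (κ ⊕ (ι ⊕ ι)) (κ ⊕ (ι ⊕ ι)) ℤ :=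
  fromBlocks X (Y * (fromRows P P)ᵀ) (fromRows P P * Z)
    (fromBlocks (U + V) (U - V) (U - V) (U + V))

theorem miyamoto_array_apply {U V : Matrix ι ι ℤ} {P : Matrix ι κ ℤ} {X Y Z : Matrix κ κ ℤ}
    (hadd : ∀ i j, (U + V) i j = 1 ∨ (U + V) i j = -1)
    (hsub : ∀ i j, (U - V) i j = 1 ∨ (U - V) i j = -1)
    (hP : ∀ i, ∃ k, ∀ l, P i l = if k = l then 1 else 0)
    (hX : ∀ k l, X k l = 1 ∨ X k l = -1) (hY : ∀ k l, Y k l = 1 ∨ Y k l = -1)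
    (hZ : ∀ k l, Z k l = 1 ∨ Z k l = -1) (a b : κ ⊕ (ι ⊕ ι)) :
    miyamoto_array U V P X Y Z a b = 1 ∨ miyamoto_array U V P X Y Z a b = -1 := by
  have hYP : ∀ k i, (Y * Pᵀ) k i = 1 ∨ (Y * Pᵀ) k i = -1 := fun k i => by
    obtain ⟨l, hl⟩ := hP i
    simpa [mul_apply, hl] using hY k l
  have hPZ : ∀ i k, (P * Z) i k = 1 ∨ (P * Z) i k = -1 := fun i k => by
    obtain ⟨l, hl⟩ := hP i
    simpa [mul_apply, hl] using hZ l k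
  rw [miyamoto_array, transpose_fromRows, mul_fromCols, fromRows_mul]
  rcases a with a | a | a <;> rcases b with b | b | b <;>
    simp only [fromBlocks_apply₁₁, fromBlocks_apply₁₂, fromBlocks_apply₂₁, fromBlocks_apply₂₂,
      fromCols_apply_inl, fromCols_apply_inr, fromRows_apply_inl, fromRows_apply_inr,
      hX, hYP, hPZ, hadd, hsub]

variable [Fintype ι] [DecidableEq ι]

theorem miyamoto_array_mul_transpose {q : ℤ} {U V : Matrix ι ι ℤ} {P : Matrix ι κ ℤ}
    {X Y Z : Matrix κ κ ℤ} (hU : U * Uᵀ = q • 1 - 2 • (P * Pᵀ)) (hV : V * Vᵀ = q • 1)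
    (hUP : U * P = -P) (hP : 2 • (Pᵀ * P) = (q - 1) • 1)
    (hX : X * Xᵀ = (4 : ℤ) • 1) (hY : Y * Yᵀ = (4 : ℤ) • 1) (hZ : Z * Zᵀ = (4 : ℤ) • 1)
    (hXZ : X * Zᵀ = 2 • Y) :
    miyamoto_array U V P X Y Z * (miyamoto_array U V P X Y Z)ᵀ = (4 * q) • 1 := by
  set L : Matrix (ι ⊕ ι) κ ℤ := fromRows P P with hL
  set S : Matrix (ι ⊕ ι) (ι ⊕ ι) ℤ := fromBlocks (U + V) (U - V) (U - V) (U + V) with hS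
  have hLL : Lᵀ * L = (q - 1) • 1 := by
    rw [← hP, hL, transpose_fromRows, fromCols_mul_fromRows, two_smul]
  have hSL : S * L = -(2 • L) := by
    rw [hS, hL, fromBlocks_mul_fromRows]
    ext (i | i) k <;>
    · have := congrFun (congrFun hUP i) k
      simp only [fromRows_apply_inl, fromRows_apply_inr, Matrix.add_mul, Matrix.sub_mul,
        Matrix.add_apply, Matrix.sub_apply, Matrix.neg_apply, Matrix.smul_apply,
        nsmul_eq_mul] at this ⊢
      push_cast
      linarith
  have hSS : S * Sᵀ = (4 * q) • 1 - 4 • (L * Lᵀ) := by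
    have h₁ : (U + V) * (U + V)ᵀ + (U - V) * (U - V)ᵀ = 2 • (U * Uᵀ + V * Vᵀ) := by
      rw [transpose_add, transpose_sub]; noncomm_ring
    have h₂ : (U + V) * (U - V)ᵀ + (U - V) * (U + V)ᵀ = 2 • (U * Uᵀ - V * Vᵀ) := by
      rw [transpose_add, transpose_sub]; noncomm_ring
    have h₃ : L * Lᵀ = fromBlocks (P * Pᵀ) (P * Pᵀ) (P * Pᵀ) (P * Pᵀ) := by
      rw [hL, transpose_fromRows, fromRows_mul_fromCols]
    rw [h₃, hS, fromBlocks_transpose, fromBlocks_multiply, h₁, h₂,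
      add_comm ((U - V) * (U + V)ᵀ), add_comm ((U - V) * (U - V)ᵀ), h₁, h₂, hU, hV,
      ← fromBlocks_one, fromBlocks_smul, fromBlocks_smul, sub_eq_add_neg (fromBlocks _ _ _ _),
      fromBlocks_neg, fromBlocks_add]
    congr 1 <;> module
  have h₁₁ : X * Xᵀ + (Y * Lᵀ) * (Y * Lᵀ)ᵀ = (4 * q) • 1 := by
    rw [transpose_mul, transpose_transpose, Matrix.mul_assoc, ← Matrix.mul_assoc Lᵀ, hLL,
      Matrix.smul_mul, Matrix.one_mul, Matrix.mul_smul, hX, hY]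
    module
  have h₁₂ : X * (L * Z)ᵀ + (Y * Lᵀ) * Sᵀ = 0 := by
    rw [transpose_mul, ← Matrix.mul_assoc, hXZ, Matrix.mul_assoc, ← transpose_mul, hSL,
      transpose_neg, transpose_smul, Matrix.mul_neg, Matrix.mul_smul, Matrix.smul_mul,
      add_neg_cancel]
  have h₂₂ : (L * Z) * (L * Z)ᵀ + S * Sᵀ = (4 * q) • 1 := by
    rw [transpose_mul, Matrix.mul_assoc, ← Matrix.mul_assoc Z, hZ, Matrix.smul_mul,
      Matrix.one_mul, Matrix.mul_smul, hSS]
    module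
  have h₂₁ : (L * Z) * Xᵀ + S * (Y * Lᵀ)ᵀ = 0 := by
    have := congrArg transpose h₁₂
    simpa only [transpose_add, transpose_mul, transpose_transpose, transpose_zero,
      Matrix.mul_assoc] using this
  rw [miyamoto_array, ← hL, ← hS, fromBlocks_transpose, fromBlocks_multiply, h₁₁, h₁₂, h₂₁, h₂₂,
    ← fromBlocks_one (l := κ) (m := ι ⊕ ι), fromBlocks_smul, smul_zero, smul_zero]

end Bordering

theorem exists_border_matrices :
    ∃ X Y Z : Matrix (Fin 2 ⊕ Fin 2) (Fin 2 ⊕ Fin 2) ℤ,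
      (X * Xᵀ = (4 : ℤ) • 1 ∧ Y * Yᵀ = (4 : ℤ) • 1 ∧ Z * Zᵀ = (4 : ℤ) • 1 ∧ X * Zᵀ = 2 • Y) ∧
      (∀ k l, X k l = 1 ∨ X k l = -1) ∧ (∀ k l, Y k l = 1 ∨ Y k l = -1) ∧
      (∀ k l, Z k l = 1 ∨ Z k l = -1) := by
  refine ⟨fromBlocks !![1, 1; -1, 1] !![1, 1; -1, 1] !![-1, -1; -1, 1] !![1, 1; 1, -1],
    fromBlocks !![1, 1; 1, -1] !![1, 1; 1, -1] !![1, 1; 1, -1] !![-1, -1; -1, 1],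
    fromBlocks !![-1, 1; 1, -1] !![1, 1; 1, 1] !![1, 1; 1, 1] !![-1, 1; 1, -1], ?_⟩
  simp only [← Matrix.ext_iff]
  refine ⟨by decide, ?_, ?_, ?_⟩ <;> rintro (k | k) (l | l) <;> fin_cases k <;> fin_cases l <;>
    simp

theorem Matrix.IsHadamard.doubling {m : Type*} [Fintype m] [DecidableEq m] {H : Matrix m m ℤ}
    (hH : H.IsHadamard) : (!![1, 1; 1, -1] ⊗ₖ H : Matrix (Fin 2 × m) (Fin 2 × m) ℤ).IsHadamard := by
  refine Matrix.IsHadamard.kronecker ⟨fun i j => ?_, ?_, ?_⟩ hH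
  · rw [Unitary.mem_iff_eq_one_or_eq_neg_one]
    fin_cases i <;> fin_cases j <;> simp
  all_goals ext i j; fin_cases i <;> fin_cases j <;> simp [mul_apply, Fin.sum_univ_two]

theorem isHadamard_of_equiv {α : Type*} [Fintype α] [DecidableEq α] {n : ℕ} (e : Fin n ≃ α)
    {M : Matrix α α ℤ} (hM : ∀ a b, M a b = 1 ∨ M a b = -1) (hMM : M * Mᵀ = (n : ℤ) • 1) :
    IsHadamard n (M.submatrix e e) := by
  refine ⟨fun i j => hM _ _, ?_⟩
  rw [transpose_submatrix, submatrix_mul_equiv, hMM, submatrix_smul, Pi.smul_apply,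
    Pi.smul_apply, submatrix_one_equiv]

/-- Miyamoto's theorem: a Hadamard matrix of order `q - 1` yields one of order `4q`. -/
theorem exists_isHadamard_four_mul_card {F : Type*} [Field F] [Fintype F] [DecidableEq F]
    (hF : Fintype.card F % 4 = 1) {W : Matrix Fˣ Fˣ ℤ} (hW : W.IsHadamard) :
    ∃ H, IsHadamard (4 * Fintype.card F) H := by
  have hchar : ringChar F ≠ 2 := fun h => by
    have := FiniteField.even_card_of_char_two h
    omega
  have hneg : quadraticChar F (-1) = 1 :=
    (quadraticChar_one_iff_isSquare (neg_ne_zero.mpr one_ne_zero)).mpr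
      (FiniteField.isSquare_neg_one_iff.mpr (by omega))
  have hcard : Fintype.card Fˣ + 1 = Fintype.card F := by
    have := Fintype.card_units F
    omega
  have hWcard : (Fintype.card Fˣ : ℤ) = (Fintype.card F : ℤ) - 1 := by
    rw [← hcard]; push_cast; ring
  have hW₁ := hW.mul_conjTranspose
  have hW₂ := hW.conjTranspose_mul
  have hWe : ∀ i j, W i j = 1 ∨ W i j = -1 := fun i j =>
    Unitary.mem_iff_eq_one_or_eq_neg_one.mp (hW.apply_mem i j)
  rw [conjTranspose_eq_transpose_of_trivial, hWcard] at hW₁ hW₂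
  obtain ⟨X, Y, Z, ⟨hX, hY, hZ, hXZ⟩, hXe, hYe, hZe⟩ := exists_border_matrices
  set U : Matrix (Fˣ ⊕ Fˣ) (Fˣ ⊕ Fˣ) ℤ :=
    fromBlocks (punctured_paley F) 0 0 (punctured_paley F) with hU
  set V : Matrix (Fˣ ⊕ Fˣ) (Fˣ ⊕ Fˣ) ℤ := fromBlocks 1 W (-Wᵀ) 1 with hV
  set P : Matrix (Fˣ ⊕ Fˣ) (Fin 2 ⊕ Fin 2) ℤ :=
    fromBlocks (residue_class F) 0 0 (residue_class F) with hP
  have hUU : U * Uᵀ = (Fintype.card F : ℤ) • 1 - 2 • (P * Pᵀ) := by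
    rw [hU, hP, fromBlocks_transpose, fromBlocks_multiply, fromBlocks_transpose,
      fromBlocks_multiply, ← fromBlocks_one, fromBlocks_smul, fromBlocks_smul,
      sub_eq_add_neg (fromBlocks _ _ _ _), fromBlocks_neg, fromBlocks_add]
    simp [punctured_paley_mul_transpose hchar hneg, sub_eq_add_neg]
  have hVV : V * Vᵀ = (Fintype.card F : ℤ) • 1 := by
    rw [hV, fromBlocks_transpose, fromBlocks_multiply, ← fromBlocks_one, fromBlocks_smul]
    congr 1
    · rw [hW₁, transpose_one, Matrix.one_mul]; module
    · simp
    · simp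
    · rw [transpose_neg, transpose_transpose, Matrix.neg_mul, Matrix.mul_neg, neg_neg, hW₂,
        transpose_one, Matrix.one_mul]
      module
  have hUP : U * P = -P := by
    rw [hU, hP, fromBlocks_multiply, fromBlocks_neg]
    simp [punctured_paley_mul_residue_class hchar hneg]
  have hPP : 2 • (Pᵀ * P) = ((Fintype.card F : ℤ) - 1) • 1 := by
    rw [hP, fromBlocks_transpose, fromBlocks_multiply, ← fromBlocks_one, fromBlocks_smul,
      fromBlocks_smul]
    simp only [transpose_zero, Matrix.zero_mul, Matrix.mul_zero, add_zero, zero_add, smul_zero,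
      residue_class_transpose_mul_self hchar]
  have hPe : ∀ i, ∃ k, ∀ l, P i l = if k = l then 1 else 0 := by
    rintro (i | i) <;> obtain ⟨k, hk⟩ := exists_residue_class_eq i
    · exact ⟨.inl k, by rintro (l | l) <;> simp [hP, hk]⟩
    · exact ⟨.inr k, by rintro (l | l) <;> simp [hP, hk]⟩
  have hdiag : ∀ i j : Fˣ, (punctured_paley F i j + (1 : Matrix Fˣ Fˣ ℤ) i j = 1 ∨
      punctured_paley F i j + (1 : Matrix Fˣ Fˣ ℤ) i j = -1) ∧
      (punctured_paley F i j - (1 : Matrix Fˣ Fˣ ℤ) i j = 1 ∨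
      punctured_paley F i j - (1 : Matrix Fˣ Fˣ ℤ) i j = -1) := fun i j => by
    by_cases hij : i = j
    · subst hij
      simp [punctured_paley_apply_self]
    · simpa [one_apply_ne hij] using punctured_paley_apply_of_ne hij
  have hadd : ∀ i j, (U + V) i j = 1 ∨ (U + V) i j = -1 := by
    rintro (i | i) (j | j)
    · simpa [hU, hV] using (hdiag i j).1
    · simpa [hU, hV] using hWe i j
    · rcases hWe j i with h | h <;> simp [hU, hV, h]
    · simpa [hU, hV] using (hdiag i j).1
  have hsub : ∀ i j, (U - V) i j = 1 ∨ (U - V) i j = -1 := by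
    rintro (i | i) (j | j)
    · simpa [hU, hV] using (hdiag i j).2
    · rcases hWe i j with h | h <;> simp [hU, hV, h]
    · simpa [hU, hV] using hWe j i
    · simpa [hU, hV] using (hdiag i j).2
  have e : Fin (4 * Fintype.card F) ≃ (Fin 2 ⊕ Fin 2) ⊕ ((Fˣ ⊕ Fˣ) ⊕ (Fˣ ⊕ Fˣ)) :=
    (Fintype.equivFinOfCardEq (by simp only [Fintype.card_sum, Fintype.card_fin]; omega)).symm
  refine ⟨_, isHadamard_of_equiv e (miyamoto_array_apply hadd hsub hPe hXe hYe hZe) ?_⟩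
  rw [miyamoto_array_mul_transpose hUU hVV hUP hPP hX hY hZ hXZ]
  push_cast
  rfl

theorem yamada_a (q : ℕ) (hq : IsPrimePow q) (hq8 : q % 8 = 1)
    (h : ∃ H : Matrix (Fin ((q - 1) / 2)) (Fin ((q - 1) / 2)) ℤ,
        IsHadamard ((q - 1) / 2) H) :
    ∃ H : Matrix (Fin (4 * q)) (Fin (4 * q)) ℤ, IsHadamard (4 * q) H := by
  classical
  obtain ⟨H, hentry, hmul⟩ := h
  obtain ⟨p, k, hp, hk, rfl⟩ := (isPrimePow_nat_iff q).mp hq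
  have : Fact p.Prime := ⟨hp⟩
  let F := GaloisField p k
  have : Fintype F := Fintype.ofFinite F
  have hcard : Fintype.card F = p ^ k := by
    rw [← Nat.card_eq_fintype_card]
    exact GaloisField.card p k hk.ne'
  have hone : 1 < p ^ k := hq.one_lt
  have hH : H.IsHadamard := by
    refine Matrix.IsHadamard.of_mul_conjTranspose
      (fun i j => Unitary.mem_iff_eq_one_or_eq_neg_one.mpr (hentry i j)) ?_ ?_
    · rw [conjTranspose_eq_transpose_of_trivial, hmul, Fintype.card_fin]
    · rw [Fintype.card_fin]
      exact IsRegular.of_ne_zero (by norm_cast; omega)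
  have e : Fin 2 × Fin ((p ^ k - 1) / 2) ≃ Fˣ := Fintype.equivOfCardEq (by
    rw [Fintype.card_prod, Fintype.card_fin, Fintype.card_fin, Fintype.card_units, hcard]
    omega)
  have hmain := exists_isHadamard_four_mul_card (F := F) (by omega) (hH.doubling.reindex e e)
  rwa [hcard] at hmain
end

section
/- Let q ≡ 1 (mod 8) be a prime power. If there exists a symmetric conference matrix of order (q+3)/2, then there exists a Hadamard matrix of order 4(q+2). -/
universe u

section NormOne

open QuadraticAlgebra

variable {F : Type*} [Field F] {d : F} {W : Type*} [CommGroup W]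
  {φ : W →* QuadraticAlgebra F d 0}

theorem re_sq_sub_mul_im_sq (hn : ∀ t, (φ t).norm = 1) (t : W) :
    (φ t).re ^ 2 - d * (φ t).im ^ 2 = 1 := by
  have := hn t
  rw [norm_def] at this
  linear_combination this

theorem map_inv_eq_star (hn : ∀ t, (φ t).norm = 1) (t : W) : φ t⁻¹ = star (φ t) := by
  have h1 : φ t * star (φ t) = 1 := by
    rw [← algebraMap_norm_eq_mul_star, hn, map_one]
  have h2 : φ t⁻¹ * φ t = 1 := by rw [← map_mul, inv_mul_cancel, map_one]
  exact left_inv_eq_right_inv h2 h1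

variable [Fintype W]

theorem eq_one_of_im_eq_zero (hn : ∀ t, (φ t).norm = 1) (hφ : Function.Injective φ)
    (hodd : Odd (Fintype.card W)) {t : W} (ht : (φ t).im = 0) : t = 1 := by
  have h := re_sq_sub_mul_im_sq hn t
  have h2 : t ^ 2 = 1 := hφ <| by
    rw [map_pow, map_one, sq]
    ext
    · rw [ht] at h
      simp [ht]
      linear_combination h
    · simp [ht]
  have h3 : orderOf t ∣ Nat.gcd 2 (Fintype.card W) :=
    Nat.dvd_gcd (orderOf_dvd_of_pow_eq_one h2) (orderOf_dvd_card)
  rw [(Nat.coprime_two_left.mpr hodd).gcd_eq_one] at h3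
  exact orderOf_eq_one_iff.mp (Nat.dvd_one.mp h3)

theorem re_ne_zero (hF : ringChar F ≠ 2) (hn : ∀ t, (φ t).norm = 1)
    (hφ : Function.Injective φ) (hodd : Odd (Fintype.card W)) (t : W) : (φ t).re ≠ 0 := by
  intro ht
  have h := re_sq_sub_mul_im_sq hn t
  have h1 : t ^ 2 = 1 := eq_one_of_im_eq_zero hn hφ hodd (by simp [sq, ht])
  have h2 : (φ (t ^ 2)).re = 1 := by simp [h1]
  rw [map_pow, sq] at h2
  simp [ht] at h2 h
  have : (2 : F) = 0 := by linear_combination -h2 - h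
  exact Ring.two_ne_zero hF this

/-- Indexing the affine line over `F` by the group `W` of norm-one elements. -/
theorem bijective_ratio [Fintype F] (hF : ringChar F ≠ 2) (hd : ¬ IsSquare d)
    (hn : ∀ t, (φ t).norm = 1)
    (hφ : Function.Injective φ) (hodd : Odd (Fintype.card W))
    (hcard : 2 * Fintype.card W = Fintype.card F + 1) :
    Function.Bijective (Sum.elim (fun t : W ↦ d * (φ t).im / (φ t).re)
      (fun t : {t : W // t ≠ 1} ↦ (φ t).re / (φ t).im)) := by
  classical
  have hre := re_ne_zero hF hn hφ hodd
  have him : ∀ t : {t : W // t ≠ 1}, (φ t).im ≠ 0 :=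
    fun t h ↦ t.2 (eq_one_of_im_eq_zero hn hφ hodd h)
  have hd0 : d ≠ 0 := fun h ↦ hd (h ▸ IsSquare.zero)
  have key : ∀ s t : W, (φ s).im * (φ t).re = (φ s).re * (φ t).im → s = t := by
    intro s t h
    have := eq_one_of_im_eq_zero hn hφ hodd (t := s * t⁻¹) (by
      rw [map_mul, map_inv_eq_star hn]; simp; linear_combination h)
    exact mul_inv_eq_one.mp this
  have key' : ∀ s t : W, (φ s).re * (φ t).re ≠ d * (φ s).im * (φ t).im := by
    intro s t h
    refine hre (s * t⁻¹) ?_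
    rw [map_mul, map_inv_eq_star hn]; simp; linear_combination h
  rw [Fintype.bijective_iff_injective_and_card]
  constructor
  · rintro (s | s) (t | t) h
    · simp only [Sum.elim_inl] at h
      rw [div_eq_div_iff (hre s) (hre t)] at h
      exact congrArg _ (key s t (mul_left_cancel₀ hd0 (by linear_combination h)))
    · simp only [Sum.elim_inl, Sum.elim_inr] at h
      rw [div_eq_div_iff (hre s) (him t)] at h
      exact absurd (by linear_combination -h) (key' s t)
    · simp only [Sum.elim_inl, Sum.elim_inr] at h
      rw [div_eq_div_iff (him s) (hre t)] at h
      exact absurd (by linear_combination h) (key' s t)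
    · simp only [Sum.elim_inr] at h
      rw [div_eq_div_iff (him s) (him t)] at h
      exact congrArg _ (Subtype.ext (key s t (by linear_combination -h)))
  · have : 0 < Fintype.card W := Fintype.card_pos
    rw [Fintype.card_sum, Fintype.card_subtype_compl, Fintype.card_subtype_eq]
    omega

theorem sum_quadraticChar_mul_eq_zero [Fintype F] [DecidableEq F] (hF : ringChar F ≠ 2)
    (hd : ¬ IsSquare d) (hn : ∀ t, (φ t).norm = 1)
    (hφ : Function.Injective φ) (hodd : Odd (Fintype.card W))
    (hcard : 2 * Fintype.card W = Fintype.card F + 1) {c : W} (hc : c ≠ 1) :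
    ∑ t, (quadraticChar F (φ (c * t)).im * quadraticChar F (φ t).im +
      quadraticChar F (φ (c * t)).re * quadraticChar F (φ t).re) = 0 := by
  classical
  have hre := re_ne_zero hF hn hφ hodd
  have him : ∀ {t : W}, t ≠ 1 → (φ t).im ≠ 0 :=
    fun h h' ↦ h (eq_one_of_im_eq_zero hn hφ hodd h')
  have h0 : ∑ x : F, quadraticChar F ((φ c).re + (φ c).im * x) = 0 := by
    rw [← quadraticChar_sum_zero hF]
    exact Fintype.sum_equiv ((Equiv.mulLeft₀ _ (him hc)).trans (Equiv.addLeft (φ c).re)) _ _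
      fun x ↦ rfl
  rw [← (bijective_ratio hF hd hn hφ hodd hcard).sum_comp, Fintype.sum_sum_type] at h0
  have h1 : ∀ a b x : F, b ≠ 0 → a = b * x → quadraticChar F a * quadraticChar F b =
      quadraticChar F x := by
    rintro a b x hb rfl
    rw [map_mul, mul_right_comm, ← sq, quadraticChar_sq_one hb, one_mul]
  rw [Finset.sum_add_distrib, ← h0, add_comm]
  congr 1
  · refine Finset.sum_congr rfl fun t _ ↦ h1 _ _ _ (hre t) ?_
    have := hre t
    simp
    field_simp
  · rw [← Fintype.sum_subtype_add_sum_subtype (fun t : W ↦ t ≠ 1)]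
    rw [add_eq_left.mpr]
    · refine Finset.sum_congr rfl fun t _ ↦ h1 _ _ _ (him t.2) ?_
      have := him t.2
      simp
      field_simp
    · refine Finset.sum_eq_zero fun t _ ↦ ?_
      have : (t : W) = 1 := not_not.mp t.2
      simp [this]

end NormOne

open QuadraticAlgebra in
theorem exists_injective_hom_quadraticAlgebra (F : Type u) [Field F] [Fintype F]
    (hF : ringChar F ≠ 2) {v : ℕ} (hv : 2 * v = Fintype.card F + 1) (hodd : Odd v) :
    ∃ (d : F) (W : Type u) (_ : CommGroup W) (_ : Fintype W) (φ : W →* QuadraticAlgebra F d 0),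
      ¬ IsSquare d ∧ Fintype.card W = v ∧ Function.Injective φ ∧ ∀ t, (φ t).norm = 1 := by
  classical
  obtain ⟨d, hd⟩ := FiniteField.exists_nonsquare hF
  have : Fact (∀ r : F, r ^ 2 ≠ d + 0 * r) :=
    ⟨fun r h ↦ hd ⟨r, by rw [← sq, h]; ring⟩⟩
  let K := QuadraticAlgebra F d 0
  let _ : Fintype K := Fintype.ofEquiv _ (equivProd d 0).symm
  have hK : Fintype.card K = Fintype.card F * Fintype.card F := by
    rw [Fintype.card_congr (equivProd d 0), Fintype.card_prod]
  obtain ⟨g, hg⟩ := IsCyclic.exists_ofOrder_eq_natCard (α := Kˣ)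
  rw [Nat.card_eq_fintype_card, Fintype.card_units, hK] at hg
  have hpos : 0 < v := hodd.pos
  have hF1 : 1 < Fintype.card F := Fintype.one_lt_card
  obtain ⟨m, hm⟩ : ∃ m, Fintype.card F = m + 1 := ⟨Fintype.card F - 1, by omega⟩
  have hg' : orderOf g = 2 * m * v := by
    rw [hg, hm]
    have : 2 * v = m + 2 := by omega
    have h2 : 2 * m * v = m * (m + 2) := by rw [← this]; ring
    rw [h2]
    exact Nat.sub_eq_of_eq_add (by ring)
  have hz : orderOf (g ^ (2 * m)) = v := by
    rw [orderOf_pow_of_dvd (by omega) (hg' ▸ dvd_mul_right _ _), hg',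
      Nat.mul_div_cancel_left _ (by omega)]
  set ζ := g ^ (2 * m)
  let _ : Fintype (Subgroup.zpowers ζ) := Fintype.ofFinite _
  refine ⟨d, Subgroup.zpowers ζ, inferInstance, inferInstance,
    (Units.coeHom K).comp (Subgroup.zpowers ζ).subtype, hd, ?_,
    Units.val_injective.comp Subtype.val_injective, fun t ↦ ?_⟩
  · rw [← Nat.card_eq_fintype_card, Nat.card_zpowers, hz]
  · let x : K := (Units.coeHom K).comp (Subgroup.zpowers ζ).subtype t
    change QuadraticAlgebra.norm x = 1
    have ht : t ^ v = 1 := by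
      rw [← hz, ← Nat.card_zpowers]
      exact pow_card_eq_one'
    have hx : x ^ v = 1 := by rw [← map_pow, ht, map_one]
    have hnv : QuadraticAlgebra.norm x ^ v = 1 := by rw [← map_pow, hx, map_one]
    have hn0 : QuadraticAlgebra.norm x ≠ 0 := fun h ↦ by simp [h, hpos.ne'] at hnv
    have hnq : QuadraticAlgebra.norm x ^ m = 1 := by
      have := FiniteField.pow_card_sub_one_eq_one _ hn0
      rwa [hm, Nat.add_sub_cancel] at this
    have hcop : Nat.Coprime v m := by
      have h2 : m = 2 * (v - 1) := by omega
      have h3 : Nat.Coprime v 2 := Nat.coprime_two_right.mpr hodd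
      have h4 : Nat.Coprime v (v - 1) :=
        (Nat.coprime_self_sub_right hpos).mpr (Nat.coprime_one_right v)
      exact h2 ▸ h3.mul_right h4
    have := Nat.dvd_gcd (orderOf_dvd_of_pow_eq_one hnv) (orderOf_dvd_of_pow_eq_one hnq)
    rw [hcop.gcd_eq_one] at this
    exact orderOf_eq_one_iff.mp (Nat.dvd_one.mp this)

section Matrices

open Matrix QuadraticAlgebra

theorem exists_isSymm_pair_of_field {F : Type*} [Field F] [Fintype F]
    (hF : Fintype.card F % 4 = 1) {v : ℕ} (hv : 2 * v = Fintype.card F + 1) :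
    ∃ R S : Matrix (Fin v) (Fin v) ℤ, R.IsSymm ∧ S.IsSymm ∧ R * S = S * R ∧
      R * R + S * S = (2 * v - 1 : ℤ) • 1 ∧ (∀ i, R i i = 0) ∧
      (∀ i j, i ≠ j → R i j = 1 ∨ R i j = -1) ∧ ∀ i j, S i j = 1 ∨ S i j = -1 := by
  classical
  have hF2 : ringChar F ≠ 2 := fun h ↦ by
    have := FiniteField.even_card_iff_char_two.mp h
    omega
  have hodd : Odd v := Nat.odd_iff.mpr (by omega)
  obtain ⟨d, W, _, _, φ, hd, hW, hφ, hn⟩ := exists_injective_hom_quadraticAlgebra F hF2 hv hodd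
  rw [← hW] at hodd hv
  have hneg : quadraticChar F (-1) = 1 := by
    rw [quadraticChar_one_iff_isSquare (neg_ne_zero.mpr one_ne_zero),
      FiniteField.isSquare_neg_one_iff]
    omega
  have him : ∀ {t : W}, t ≠ 1 → (φ t).im ≠ 0 :=
    fun h h' ↦ h (eq_one_of_im_eq_zero hn hφ hodd h')
  have hre := re_ne_zero hF2 hn hφ hodd
  let r : W → ℤ := fun t ↦ quadraticChar F (φ t).im
  let s : W → ℤ := fun t ↦ quadraticChar F (φ t).re
  have hr1 : r 1 = 0 := by simp [r]
  have hr : ∀ t, r t⁻¹ = r t := fun t ↦ by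
    simp only [r, map_inv_eq_star hn, im_star]
    rw [← neg_one_mul, map_mul, hneg, one_mul]
  have hs : ∀ t, s t⁻¹ = s t := fun t ↦ by
    simp [s, map_inv_eq_star hn]
  have hrpm : ∀ t ≠ 1, r t = 1 ∨ r t = -1 := fun t ht ↦ quadraticChar_dichotomy (him ht)
  have hspm : ∀ t, s t = 1 ∨ s t = -1 := fun t ↦ quadraticChar_dichotomy (hre t)
  have hsum : ∀ c, ∑ t, (r (c * t) * r t + s (c * t) * s t) =
      if c = 1 then (2 * v - 1 : ℤ) else 0 := by
    intro c
    split_ifs with hc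
    · have h1 : ∀ t, r (c * t) * r t + s (c * t) * s t = 2 - if t = 1 then 1 else 0 := by
        intro t
        rw [hc, one_mul]
        rcases hspm t with h | h <;> by_cases ht : t = 1
        · subst ht; simp [h, hr1]
        · rcases hrpm t ht with h' | h' <;> simp [h, h', ht]
        · subst ht; simp [h, hr1]
        · rcases hrpm t ht with h' | h' <;> simp [h, h', ht]
      rw [Finset.sum_congr rfl fun t _ ↦ h1 t]
      simp [hW, mul_comm]
    · exact sum_quadraticChar_mul_eq_zero hF2 hd hn hφ hodd hv hc
  let e : Fin v ≃ W := (Fintype.equivFinOfCardEq hW).symm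
  let R : Matrix W W ℤ := of fun x y ↦ r (x * y⁻¹)
  let S : Matrix W W ℤ := of fun x y ↦ s (x * y⁻¹)
  have hRS : R * S = S * R := by
    ext x y
    simp only [mul_apply, R, S, of_apply]
    refine Fintype.sum_equiv ((Equiv.inv W).trans (Equiv.mulLeft (x * y))) _ _ fun t ↦ ?_
    have h1 : x * (x * y * t⁻¹)⁻¹ = t * y⁻¹ := by
      rw [mul_assoc x y, mul_inv, mul_inv_cancel_left, mul_inv, inv_inv, mul_comm]
    have h2 : x * y * t⁻¹ * y⁻¹ = x * t⁻¹ := by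
      rw [mul_inv_eq_iff_eq_mul, mul_right_comm]
    simp only [Equiv.trans_apply, Equiv.inv_apply, Equiv.coe_mulLeft, h1, h2]
    exact mul_comm _ _
  have hR : R.IsSymm := by
    ext x y
    simp only [transpose_apply, R, of_apply]
    rw [← hr]; simp
  have hS : S.IsSymm := by
    ext x y
    simp only [transpose_apply, S, of_apply]
    rw [← hs]; simp
  have hRR : R * R + S * S = (2 * v - 1 : ℤ) • 1 := by
    ext x y
    have h1 : (R * R + S * S) x y = ∑ t, (r (x * y⁻¹ * t) * r t + s (x * y⁻¹ * t) * s t) := by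
      simp only [Matrix.add_apply, mul_apply, ← Finset.sum_add_distrib]
      refine Fintype.sum_equiv ((Equiv.inv W).trans (Equiv.mulLeft y)) _ _ fun t ↦ ?_
      have h2 : x * y⁻¹ * (y * t⁻¹) = x * t⁻¹ := by simp [mul_assoc]
      have h3 : (t * y⁻¹)⁻¹ = y * t⁻¹ := by simp
      simp only [R, S, of_apply]
      rw [← hr (t * y⁻¹), ← hs (t * y⁻¹), h3]
      simp [h2]
    rw [h1, hsum]
    simp [Matrix.one_apply, mul_inv_eq_one]
  refine ⟨R.submatrix e e, S.submatrix e e, hR.submatrix _, hS.submatrix _, ?_, ?_, ?_, ?_, ?_⟩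
  · rw [submatrix_mul_equiv, submatrix_mul_equiv, hRS]
  · rw [submatrix_mul_equiv, submatrix_mul_equiv, ← Pi.add_apply, ← Pi.add_apply,
      ← submatrix_add, hRR, submatrix_smul, Pi.smul_apply, Pi.smul_apply, submatrix_one_equiv]
  · simp [R, hr1]
  · intro i j hij
    exact hrpm _ (by simpa [mul_inv_eq_one] using hij)
  · exact fun i j ↦ hspm _

theorem exists_isSymm_pair {q v : ℕ} (hq : IsPrimePow q) (hq4 : q % 4 = 1) (hv : 2 * v = q + 1) :
    ∃ R S : Matrix (Fin v) (Fin v) ℤ, R.IsSymm ∧ S.IsSymm ∧ R * S = S * R ∧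
      R * R + S * S = (2 * v - 1 : ℤ) • 1 ∧ (∀ i, R i i = 0) ∧
      (∀ i j, i ≠ j → R i j = 1 ∨ R i j = -1) ∧ ∀ i j, S i j = 1 ∨ S i j = -1 := by
  obtain ⟨p, k, hp, hk, rfl⟩ := (isPrimePow_nat_iff q).mp hq
  have : Fact p.Prime := ⟨hp⟩
  let _ : Fintype (GaloisField p k) := Fintype.ofFinite _
  have hF : Fintype.card (GaloisField p k) = p ^ k := by
    rw [← Nat.card_eq_fintype_card, GaloisField.card p k hk.ne']
  exact exists_isSymm_pair_of_field (F := GaloisField p k) (hF ▸ hq4) (hF ▸ hv)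

section Williamson

variable {κ : Type*} [Fintype κ] [DecidableEq κ]

theorem fromBlocks_pm {l m n o : Type*} {A : Matrix n l ℤ} {B : Matrix n m ℤ}
    {C : Matrix o l ℤ} {D : Matrix o m ℤ}
    (hA : ∀ i j, A i j = 1 ∨ A i j = -1) (hB : ∀ i j, B i j = 1 ∨ B i j = -1)
    (hC : ∀ i j, C i j = 1 ∨ C i j = -1) (hD : ∀ i j, D i j = 1 ∨ D i j = -1) (i j) :
    fromBlocks A B C D i j = 1 ∨ fromBlocks A B C D i j = -1 := by
  rcases i with i | i <;> rcases j with j | j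
  exacts [hA i j, hB i j, hC i j, hD i j]

theorem neg_pm {m n : Type*} {A : Matrix m n ℤ} (hA : ∀ i j, A i j = 1 ∨ A i j = -1) (i j) :
    (-A) i j = 1 ∨ (-A) i j = -1 := by
  rcases hA i j with h | h <;> simp [h]

/-- The Williamson array evaluated at four pairwise amicable matrices. -/
theorem exists_isHadamard_of_amicable (X : Fin 4 → Matrix κ κ ℤ)
    (hpm : ∀ k i j, X k i j = 1 ∨ X k i j = -1)
    (hX : ∀ k l, X k * (X l)ᵀ = X l * (X k)ᵀ) {n : ℕ} (hn : n = 4 * Fintype.card κ)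
    (hsum : ∑ k, X k * (X k)ᵀ = (n : ℤ) • 1) :
    ∃ H : Matrix (Fin n) (Fin n) ℤ, IsHadamard n H := by
  let M : Matrix ((κ ⊕ κ) ⊕ (κ ⊕ κ)) ((κ ⊕ κ) ⊕ (κ ⊕ κ)) ℤ :=
    fromBlocks (fromBlocks (X 0) (X 1) (-X 1) (X 0)) (fromBlocks (X 2) (X 3) (-X 3) (X 2))
      (fromBlocks (-X 2) (X 3) (-X 3) (-X 2)) (fromBlocks (X 0) (-X 1) (X 1) (X 0))
  have hM : ∀ i j, M i j = 1 ∨ M i j = -1 := by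
    repeat' first | exact hpm _ | apply fromBlocks_pm | apply neg_pm
  have hMM : M * Mᵀ = (n : ℤ) • 1 := by
    rw [Fin.sum_univ_four] at hsum
    have e01 := hX 0 1
    have e02 := hX 0 2
    have e03 := hX 0 3
    have e12 := hX 1 2
    have e13 := hX 1 3
    have e23 := hX 2 3
    simp only [M, fromBlocks_transpose, fromBlocks_multiply, ← fromBlocks_one, fromBlocks_smul,
      fromBlocks_add, transpose_neg, Matrix.neg_mul, Matrix.mul_neg, neg_neg, ← hsum, e01, e02,
      e03, e12, e13, e23, smul_zero]
    rw [← fromBlocks_zero]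
    congr 2 <;> abel
  have hc : Fintype.card ((κ ⊕ κ) ⊕ (κ ⊕ κ)) = n := by
    simp only [Fintype.card_sum]; omega
  let e := (Fintype.equivFinOfCardEq hc).symm
  refine ⟨M.submatrix e e, fun i j ↦ hM _ _, ?_⟩
  rw [transpose_submatrix, submatrix_mul_equiv, hMM, submatrix_smul, Pi.smul_apply,
    Pi.smul_apply, submatrix_one_equiv]

end Williamson

section Miyamoto

variable {ι : Type*} [Fintype ι]

theorem border_mul_border_transpose (s t : ℤ) (A B : Matrix ι ι ℤ) :
    fromBlocks (1 : Matrix Unit Unit ℤ) (of fun _ _ ↦ s) (of fun _ _ ↦ s) A *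
      (fromBlocks (1 : Matrix Unit Unit ℤ) (of fun _ _ ↦ t) (of fun _ _ ↦ t) B)ᵀ =
    fromBlocks (of fun _ _ ↦ 1 + s * t * Fintype.card ι)
      (of fun _ j ↦ t + s * ∑ k, B j k) (of fun i _ ↦ s + t * ∑ k, A i k)
      (of (fun _ _ ↦ s * t) + A * Bᵀ) := by
  rw [fromBlocks_transpose, fromBlocks_multiply]
  congr 1 <;> ext i j <;> simp [mul_apply, Finset.mul_sum, mul_comm]

/-- Miyamoto's construction. -/
theorem exists_isHadamard_of_miyamoto [DecidableEq ι] (U V : Fin 4 → Matrix ι ι ℤ)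
    (hU : ∀ k l, U k * (U l)ᵀ = U l * (U k)ᵀ) (hV : ∀ k l, V k * (V l)ᵀ = V l * (V k)ᵀ)
    (hadd : ∀ k i j, (U k + V k) i j = 1 ∨ (U k + V k) i j = -1)
    (hsub : ∀ k i j, (U k - V k) i j = 1 ∨ (U k - V k) i j = -1)
    (hrow : ∀ k i, ∑ j, U k i j = if k = 0 then 1 else 0)
    (hUU : ∑ k, U k * (U k)ᵀ = (2 * Fintype.card ι + 1 : ℤ) • 1 - of fun _ _ ↦ 2)
    (hVV : ∑ k, V k * (V k)ᵀ = (2 * Fintype.card ι + 1 : ℤ) • 1) {n : ℕ}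
    (hn : n = 4 * (2 * Fintype.card ι + 1)) :
    ∃ H : Matrix (Fin n) (Fin n) ℤ, IsHadamard n H := by
  let T : Fin 4 → Matrix (ι ⊕ ι) (ι ⊕ ι) ℤ := fun k ↦
    fromBlocks (U k + V k) (U k - V k) (U k - V k) (U k + V k)
  have hTmul : ∀ k l, T k * (T l)ᵀ = (2 : ℤ) • fromBlocks (U k * (U l)ᵀ + V k * (V l)ᵀ)
      (U k * (U l)ᵀ - V k * (V l)ᵀ) (U k * (U l)ᵀ - V k * (V l)ᵀ)
      (U k * (U l)ᵀ + V k * (V l)ᵀ) := by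
    intro k l
    simp only [T, fromBlocks_transpose, fromBlocks_multiply, fromBlocks_smul, transpose_add,
      transpose_sub]
    congr 1 <;> noncomm_ring
  have hTrow : ∀ k i, ∑ j, T k i j = if k = 0 then 2 else 0 := by
    intro k i
    have := hrow k
    rcases i with i | i <;>
      simp [T, Finset.sum_add_distrib, Finset.sum_sub_distrib, this] <;> split_ifs <;> rfl
  let s : Fin 4 → ℤ := fun k ↦ if k = 0 then -1 else 1
  have hTT : ∑ k, T k * (T k)ᵀ = (n : ℤ) • 1 - of fun _ _ ↦ 4 := by
    simp only [hTmul, ← Finset.smul_sum]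
    have : ∀ A B C D : Fin 4 → Matrix ι ι ℤ, ∑ k, fromBlocks (A k) (B k) (C k) (D k) =
        fromBlocks (∑ k, A k) (∑ k, B k) (∑ k, C k) (∑ k, D k) := by
      intro A B C D
      simp [Fin.sum_univ_four, fromBlocks_add]
    rw [this, Finset.sum_add_distrib, Finset.sum_sub_distrib, hUU, hVV, hn]
    ext (i | i) (j | j) <;>
      simp only [Matrix.smul_apply, Matrix.sub_apply, Matrix.add_apply, Matrix.one_apply, of_apply,
        fromBlocks_apply₁₁, fromBlocks_apply₁₂, fromBlocks_apply₂₁, fromBlocks_apply₂₂,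
        smul_eq_mul, Sum.inl.injEq, Sum.inr.injEq, reduceCtorEq, if_false] <;>
      push_cast <;> ring
  refine exists_isHadamard_of_amicable
    (fun k ↦ fromBlocks (1 : Matrix Unit Unit ℤ) (of fun _ _ ↦ s k) (of fun _ _ ↦ s k) (T k))
    (fun k ↦ ?_) (fun k l ↦ ?_) (n := n) ?_ ?_
  · have hs : s k = 1 ∨ s k = -1 := by
      simp only [s]; split_ifs <;> simp
    refine fromBlocks_pm (fun i j ↦ Or.inl rfl) (fun _ _ ↦ hs) (fun _ _ ↦ hs) ?_
    exact fromBlocks_pm (hadd k) (hsub k) (hsub k) (hadd k)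
  · rw [border_mul_border_transpose, border_mul_border_transpose]
    simp only [hTrow]
    congr 1
    · ext; simp only [of_apply]; ring
    · ext; simp only [of_apply, s]; split_ifs <;> rfl
    · ext; simp only [of_apply, s]; split_ifs <;> rfl
    · rw [mul_comm (s k), hTmul, hTmul, hU, hV]
  · simp; omega
  · have h4 : ∀ i j, (∑ k, T k * (T k)ᵀ) i j = ((n : ℤ) • 1 - of fun _ _ ↦ (4 : ℤ)) i j :=
      fun i j ↦ by rw [hTT]
    simp only [border_mul_border_transpose, hTrow]
    rw [← fromBlocks_one, fromBlocks_smul]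
    simp only [Fin.sum_univ_four, fromBlocks_add] at h4 ⊢
    congr 1
    · ext; simp [s, hn]; ring
    · ext i j
      have := h4 i j
      simp only [Matrix.add_apply, Matrix.sub_apply, of_apply] at this ⊢
      linear_combination this + (by simp [s] :
        s 0 * s 0 + s 1 * s 1 + s 2 * s 2 + s 3 * s 3 = 4)

end Miyamoto

theorem IsConference.exists_core {n : ℕ} {C : Matrix (Fin (n + 1)) (Fin (n + 1)) ℤ}
    (hC : IsConference (n + 1) C) (hsymm : C.IsSymm) :
    ∃ Q : Matrix (Fin n) (Fin n) ℤ, Q.IsSymm ∧ (∀ i, Q i i = 0) ∧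
      (∀ i j, i ≠ j → Q i j = 1 ∨ Q i j = -1) ∧ (∀ i, ∑ j, Q i j = 0) ∧
      Q * Q = (n : ℤ) • 1 - of fun _ _ ↦ 1 := by
  obtain ⟨hdiag, hoff, hmul⟩ := hC
  rw [hsymm.eq] at hmul
  let u : Fin n → ℤ := fun i ↦ C 0 i.succ
  have hu : ∀ i, u i = 1 ∨ u i = -1 := fun i ↦ hoff _ _ (Fin.succ_ne_zero i).symm
  have huu : ∀ i, u i * u i = 1 := fun i ↦ by rcases hu i with h | h <;> simp [h]
  have hu' : ∀ i, C i.succ 0 = u i := fun i ↦ hsymm.apply _ _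
  have hrow : ∀ i, ∑ j, C (Fin.succ i) (Fin.succ j) * u j = 0 := fun i ↦ by
    have := congr_fun₂ hmul i.succ 0
    rw [mul_apply, Fin.sum_univ_succ, hdiag] at this
    simpa [hu'] using this
  have hprod : ∀ i j, u i * u j + ∑ k, C (Fin.succ i) (Fin.succ k) * C (Fin.succ k) (Fin.succ j) =
      if i = j then (n : ℤ) else 0 := fun i j ↦ by
    have := congr_fun₂ hmul i.succ j.succ
    rw [mul_apply, Fin.sum_univ_succ, hu'] at this
    simpa [Matrix.one_apply] using this
  refine ⟨of fun i j ↦ u i * C i.succ j.succ * u j, ?_, ?_, ?_, ?_, ?_⟩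
  · ext i j
    simp only [transpose_apply, of_apply, hsymm.apply i.succ j.succ]
    ring
  · simp [hdiag]
  · intro i j hij
    have := hoff i.succ j.succ (by simpa using hij)
    rcases hu i with h | h <;> rcases hu j with h' | h' <;> rcases this with h'' | h'' <;>
      simp [h, h', h'']
  · intro i
    simp only [of_apply, mul_assoc, ← Finset.mul_sum, hrow, mul_zero]
  · ext i j
    have h1 : ∀ k, u i * C i.succ k.succ * u k * (u k * C k.succ j.succ * u j) =
        u i * u j * (C i.succ k.succ * C k.succ j.succ) := fun k ↦ by
      linear_combination u i * C i.succ k.succ * C k.succ j.succ * u j * huu k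
    simp only [mul_apply, of_apply, h1, ← Finset.mul_sum]
    rw [← sub_eq_of_eq_add' (hprod i j).symm]
    simp only [Matrix.sub_apply, Matrix.smul_apply, Matrix.one_apply, of_apply, smul_eq_mul]
    split_ifs with hij
    · subst hij
      linear_combination (n - 1 - u i * u i) * huu i
    · linear_combination -huu j * (u i * u i) - huu i

theorem exists_isHadamard_of_isSymm {v : ℕ} {Q R S : Matrix (Fin v) (Fin v) ℤ}
    (hQ : Q.IsSymm) (hQ0 : ∀ i, Q i i = 0) (hQpm : ∀ i j, i ≠ j → Q i j = 1 ∨ Q i j = -1)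
    (hQrow : ∀ i, ∑ j, Q i j = 0) (hQQ : Q * Q = (v : ℤ) • 1 - of fun _ _ ↦ 1)
    (hR : R.IsSymm) (hS : S.IsSymm) (hRS : R * S = S * R)
    (hRR : R * R + S * S = (2 * v - 1 : ℤ) • 1) (hR0 : ∀ i, R i i = 0)
    (hRpm : ∀ i j, i ≠ j → R i j = 1 ∨ R i j = -1) (hSpm : ∀ i j, S i j = 1 ∨ S i j = -1) :
    ∃ H : Matrix (Fin (4 * (2 * v + 1))) (Fin (4 * (2 * v + 1))) ℤ,
      IsHadamard (4 * (2 * v + 1)) H := by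
  have diag_pm : ∀ A : Matrix (Fin v) (Fin v) ℤ, (∀ i, A i i = 0) →
      (∀ i j, i ≠ j → A i j = 1 ∨ A i j = -1) → ∀ i j,
      ((1 + A) i j = 1 ∨ (1 + A) i j = -1) ∧ ((A + 1) i j = 1 ∨ (A + 1) i j = -1) ∧
        ((1 - A) i j = 1 ∨ (1 - A) i j = -1) ∧ ((A - 1) i j = 1 ∨ (A - 1) i j = -1) := by
    intro A h0 h1 i j
    by_cases hij : i = j
    · subst hij
      simp [h0]
    · rcases h1 i j hij with h | h <;> simp [hij, h]
  have hSn := neg_pm hSpm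
  refine exists_isHadamard_of_miyamoto ![1, 0, Q, Q] ![R, S, 1, 1] ?_ ?_ ?_ ?_ ?_ ?_ ?_
    (by rw [Fintype.card_fin])
  · intro k l
    fin_cases k <;> fin_cases l <;> simp [hQ.eq]
  · intro k l
    fin_cases k <;> fin_cases l <;> simp [hR.eq, hS.eq, hRS]
  · intro k i j
    fin_cases k
    · exact (diag_pm R hR0 hRpm i j).1
    · simpa using hSpm i j
    · exact (diag_pm Q hQ0 hQpm i j).2.1
    · exact (diag_pm Q hQ0 hQpm i j).2.1
  · intro k i j
    fin_cases k
    · exact (diag_pm R hR0 hRpm i j).2.2.1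
    · simpa using hSn i j
    · exact (diag_pm Q hQ0 hQpm i j).2.2.2
    · exact (diag_pm Q hQ0 hQpm i j).2.2.2
  · intro k i
    fin_cases k
    · change ∑ j, (1 : Matrix (Fin v) (Fin v) ℤ) i j = 1
      simp [Matrix.one_apply]
    · exact Finset.sum_const_zero
    · exact hQrow i
    · exact hQrow i
  · rw [Fin.sum_univ_four, Fintype.card_fin]
    change (1 : Matrix (Fin v) (Fin v) ℤ) * transpose 1 + 0 * transpose 0 + Q * Qᵀ + Q * Qᵀ = _
    rw [hQ.eq, hQQ, transpose_one, mul_one, zero_mul]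
    ext i j
    simp only [Matrix.add_apply, Matrix.sub_apply, Matrix.smul_apply, Matrix.zero_apply, of_apply,
      smul_eq_mul]
    ring
  · rw [Fin.sum_univ_four, Fintype.card_fin]
    change R * Rᵀ + S * Sᵀ + 1 * transpose 1 + 1 * transpose 1 = _
    rw [hR.eq, hS.eq, hRR, transpose_one, mul_one]
    module

end Matrices

theorem yamada_b (q : ℕ) (hq : IsPrimePow q) (hq8 : q % 8 = 1)
    (h : ∃ C : Matrix (Fin ((q + 3) / 2)) (Fin ((q + 3) / 2)) ℤ,
        IsConference ((q + 3) / 2) C ∧ C.transpose = C) :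
    ∃ H : Matrix (Fin (4 * (q + 2))) (Fin (4 * (q + 2))) ℤ,
      IsHadamard (4 * (q + 2)) H := by
  obtain ⟨v, hv⟩ : ∃ v, 2 * v = q + 1 := ⟨(q + 1) / 2, by omega⟩
  have h1 : (q + 3) / 2 = v + 1 := by omega
  have h2 : q + 2 = 2 * v + 1 := by omega
  rw [h1] at h
  rw [h2]
  obtain ⟨C, hC, hsymm⟩ := h
  obtain ⟨Q, hQ, hQ0, hQpm, hQrow, hQQ⟩ := hC.exists_core hsymm
  obtain ⟨R, S, hR, hS, hRS, hRR, hR0, hRpm, hSpm⟩ := exists_isSymm_pair hq (by omega) hv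
  exact exists_isHadamard_of_isSymm hQ hQ0 hQpm hQrow hQQ hR hS hRS hRR hR0 hRpm hSpm
end

section
/- If q ≡ 5 (mod 8) is a prime power and there exists a skew Hadamard matrix of order (q+3)/2, then there exists a Hadamard matrix of order 4(q+2). -/
/-- A skew Hadamard matrix: a Hadamard matrix `H` with `H - I` skew-symmetric. -/
def IsSkewHadamard (n : ℕ) (H : Matrix (Fin n) (Fin n) ℤ) : Prop :=
  IsHadamard n H ∧ (H - 1).transpose = -(H - 1)

/-- The symplectic form on `F × F`. -/
def planeDet {F : Type*} [Field F] (v w : F × F) : F := v.1 * w.2 - v.2 * w.1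

/-- Multiplication by `√ν` on `F × F ≅ F(√ν)`. -/
def mulSqrt {F : Type*} [Field F] (ν : F) (v : F × F) : F × F := (ν * v.2, v.1)

/-- A representative vector of a point of the projective line `Option F`. -/
def projRep {F : Type*} [Field F] : Option F → F × F
  | none => (1, 0)
  | some t => (t, 1)

/-- The involution induced by `mulSqrt ν` on the projective line. -/
def projInvol {F : Type*} [Field F] [DecidableEq F] (ν : F) : Option F → Option F
  | none => some 0
  | some t => if t = 0 then none else some (ν / t)

section Plane

variable {F : Type*} [Field F]

lemma planeDet_self (v : F × F) : planeDet v v = 0 := by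
  simp only [planeDet]; ring

lemma planeDet_swap (v w : F × F) : planeDet v w = -planeDet w v := by
  simp only [planeDet]; ring

lemma planeDet_smul_right (c : F) (v w : F × F) :
    planeDet v (c • w) = c * planeDet v w := by
  simp only [planeDet, Prod.smul_fst, Prod.smul_snd, smul_eq_mul]; ring

lemma planeDet_mulSqrt_left (ν : F) (v w : F × F) :
    planeDet (mulSqrt ν v) w = -planeDet v (mulSqrt ν w) := by
  simp only [planeDet, mulSqrt]; ring

lemma planeDet_mulSqrt_mulSqrt (ν : F) (v w : F × F) :
    planeDet (mulSqrt ν v) (mulSqrt ν w) = -ν * planeDet v w := by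
  simp only [planeDet, mulSqrt]; ring

lemma projRep_ne_zero (p : Option F) : projRep p ≠ 0 := by
  cases p <;> simp [projRep]

lemma eq_of_planeDet_projRep_eq_zero {p r : Option F}
    (h : planeDet (projRep p) (projRep r) = 0) : p = r := by
  cases p <;> cases r <;> simp [planeDet, projRep] at h ⊢
  linear_combination h

lemma planeDet_map_injective {x y : F × F} (h : planeDet x y ≠ 0) :
    Function.Injective fun v : F × F => (planeDet x v, planeDet y v) := by
  intro v w hvw
  simp only [planeDet, Prod.mk.injEq] at h hvw
  obtain ⟨h1, h2⟩ := hvw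
  ext
  · apply mul_left_cancel₀ h
    linear_combination y.1 * h1 - x.1 * h2
  · apply mul_left_cancel₀ h
    linear_combination y.2 * h1 - x.2 * h2

lemma exists_planeDet_ne_zero {x : F × F} (hx : x ≠ 0) : ∃ y, planeDet x y ≠ 0 := by
  by_contra! h
  apply hx
  have h1 := h (0, 1)
  have h2 := h (1, 0)
  simp only [planeDet] at h1 h2
  ext
  · simpa using h1
  · simpa using h2

variable [DecidableEq F]

lemma projInvol_projInvol {ν : F} (hν : ν ≠ 0) (p : Option F) :
    projInvol ν (projInvol ν p) = p := by
  cases p with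
  | none => simp [projInvol]
  | some t =>
    by_cases ht : t = 0
    · simp [projInvol, ht]
    · simp [projInvol, ht, hν]

lemma exists_mulSqrt_projRep {ν : F} (hν : ν ≠ 0) (p : Option F) :
    ∃ c : F, c ≠ 0 ∧ mulSqrt ν (projRep p) = c • projRep (projInvol ν p) := by
  cases p with
  | none => exact ⟨1, one_ne_zero, by simp [mulSqrt, projRep, projInvol]⟩
  | some t =>
    by_cases ht : t = 0
    · exact ⟨ν, hν, by simp [mulSqrt, projRep, projInvol, ht]⟩
    · exact ⟨t, ht, by simp [mulSqrt, projRep, projInvol, ht]; field_simp⟩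

lemma planeDet_mulSqrt_ne_zero {ν : F} (hν : ¬ IsSquare ν) {x : F × F} (hx : x ≠ 0) :
    planeDet x (mulSqrt ν x) ≠ 0 := by
  intro h
  simp only [planeDet, mulSqrt] at h
  by_cases h2 : x.2 = 0
  · apply hx
    ext
    · simpa [h2] using h
    · simpa using h2
  · apply hν
    refine ⟨x.1 / x.2, ?_⟩
    field_simp
    linear_combination -h

lemma projInvol_ne {ν : F} (hν : ¬ IsSquare ν) (p : Option F) : projInvol ν p ≠ p := by
  intro h
  have hν0 : ν ≠ 0 := by rintro rfl; exact hν (IsSquare.zero)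
  obtain ⟨c, -, hc⟩ := exists_mulSqrt_projRep hν0 p
  apply planeDet_mulSqrt_ne_zero hν (projRep_ne_zero p)
  rw [hc, h, planeDet_smul_right, planeDet_self, mul_zero]

variable [Fintype F]

lemma sum_quadraticChar_planeDet_mul {x y : F × F} (hF : ringChar F ≠ 2)
    (h : planeDet x y ≠ 0) :
    ∑ v, quadraticChar F (planeDet x v) * quadraticChar F (planeDet y v) = 0 := by
  have hb := Finite.injective_iff_bijective.mp (planeDet_map_injective h)
  rw [Fintype.sum_bijective _ hb _
    (fun w : F × F => quadraticChar F w.1 * quadraticChar F w.2) (fun _ => rfl),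
    Fintype.sum_prod_type]
  simp only [← Finset.mul_sum, quadraticChar_sum_zero hF, mul_zero, Finset.sum_const_zero]

lemma sum_quadraticChar_planeDet_sq {x : F × F} (hx : x ≠ 0) :
    ∑ v, quadraticChar F (planeDet x v) * quadraticChar F (planeDet x v) =
      ((Fintype.card F : ℤ) - 1) * Fintype.card F := by
  obtain ⟨y, hy⟩ := exists_planeDet_ne_zero hx
  have hb := Finite.injective_iff_bijective.mp (planeDet_map_injective hy)
  rw [Fintype.sum_bijective _ hb _
    (fun w : F × F => quadraticChar F w.1 * quadraticChar F w.1) (fun _ => rfl),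
    Fintype.sum_prod_type]
  have hsq (a : F) : quadraticChar F a * quadraticChar F a = 1 - if a = 0 then 1 else 0 := by
    by_cases ha : a = 0
    · simp [ha]
    · simpa [ha, sq] using quadraticChar_sq_one ha
  simp only [hsq]
  simp
  ring

lemma sum_plane_eq_mul_sum_proj (f : F × F → ℤ) (h0 : f 0 = 0)
    (hf : ∀ (c : F) v, c ≠ 0 → f (c • v) = f v) :
    ∑ v, f v = ((Fintype.card F : ℤ) - 1) * ∑ p, f (projRep p) := by
  have hcard (a : ℤ) : ∑ c : F, (if c = 0 then 0 else a) = ((Fintype.card F : ℤ) - 1) * a := by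
    have (c : F) : (if c = 0 then 0 else a) = a - if c = 0 then a else 0 := by
      split_ifs <;> simp
    simp [this, sub_mul]
  rw [Fintype.sum_prod_type, Finset.sum_comm, Fintype.sum_option, mul_add]
  have hrow (b : F) (hb : b ≠ 0) : ∑ a, f (a, b) = ∑ t : F, f (t, 1) := by
    rw [← Equiv.sum_comp (Equiv.mulLeft₀ b hb)]
    refine Finset.sum_congr rfl fun t _ => ?_
    simpa using hf b (t, 1) hb
  have hrow0 : ∑ a, f (a, 0) = ((Fintype.card F : ℤ) - 1) * f (1, 0) := by
    rw [← hcard]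
    refine Finset.sum_congr rfl fun a _ => ?_
    split_ifs with ha
    · rw [ha]; exact h0
    · simpa using hf a (1, 0) ha
  have hsplit (b : F) : ∑ a, f (a, b) =
      (if b = 0 then ((Fintype.card F : ℤ) - 1) * f (1, 0) else 0) +
        if b = 0 then 0 else ∑ t : F, f (t, 1) := by
    split_ifs with hb
    · rw [hb, hrow0, add_zero]
    · rw [hrow b hb, zero_add]
  rw [Finset.sum_congr rfl fun b _ => hsplit b, Finset.sum_add_distrib, hcard]
  simp [projRep]

end Plane

lemma sum_eq_sum_lt_involution {P : Type*} [Fintype P] [LinearOrder P] {σ : P → P}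
    (hσ : ∀ p, σ (σ p) = p) (hne : ∀ p, σ p ≠ p) (f : P → ℤ) :
    ∑ p, f p = ∑ i : {p // p < σ p}, (f i + f (σ i)) := by
  have h2 : ∑ i ∈ Finset.univ.filter (fun p => ¬ p < σ p), f i =
      ∑ i ∈ Finset.univ.filter (fun p => p < σ p), f (σ i) := by
    refine Finset.sum_nbij' σ σ ?_ ?_ ?_ ?_ ?_ <;>
      simp only [Finset.mem_filter, Finset.mem_univ, true_and, hσ, implies_true, not_lt]
    · intro p hp
      exact lt_of_le_of_ne hp (hne p)
    · exact fun p hp => hp.le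
  rw [← Finset.sum_filter_add_sum_filter_not Finset.univ (fun p => p < σ p), h2,
    ← Finset.sum_add_distrib]
  exact (Finset.sum_subtype _ (by simp) _)

/-- Two symmetric commuting matrices forming a conference matrix `[A, B; B, -A]`. -/
structure IsConferencePair {ι : Type*} [Fintype ι] [DecidableEq ι] (q : ℤ)
    (A B : Matrix ι ι ℤ) : Prop where
  diag : ∀ i, A i i = 0
  offDiag : ∀ i j, i ≠ j → A i j = 1 ∨ A i j = -1
  entries : ∀ i j, B i j = 1 ∨ B i j = -1
  symm_left : A.transpose = A
  symm_right : B.transpose = B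
  sum_sq : A * A + B * B = q • 1
  comm : A * B = B * A

theorem exists_isConferencePair (F : Type) [Field F] [Fintype F] (hF : Fintype.card F % 4 = 1) :
    ∃ (ι : Type) (_ : Fintype ι) (_ : DecidableEq ι) (A B : Matrix ι ι ℤ),
      2 * Fintype.card ι = Fintype.card F + 1 ∧ IsConferencePair (Fintype.card F) A B := by
  classical
  have hchar : ringChar F ≠ 2 := by
    intro h
    have := FiniteField.even_card_of_char_two h
    omega
  have hq1 : ((Fintype.card F : ℤ) - 1) ≠ 0 := by
    have := Fintype.one_lt_card (α := F)
    omega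
  obtain ⟨ν, hν⟩ := quadraticChar_exists_neg_one hchar
  have hνsq : ¬ IsSquare ν := quadraticChar_neg_one_iff_not_isSquare.mp hν
  have hν0 : ν ≠ 0 := by rintro rfl; exact hνsq (IsSquare.zero)
  have hneg (a : F) : quadraticChar F (-a) = quadraticChar F a := by
    have : quadraticChar F (-1) = 1 :=
      (quadraticChar_one_iff_isSquare (neg_ne_zero.mpr one_ne_zero)).mpr
        (FiniteField.isSquare_neg_one_iff.mpr (by omega))
    rw [neg_eq_neg_one_mul, map_mul, this, one_mul]
  have hconj (v w : F × F) : quadraticChar F (planeDet (mulSqrt ν v) (mulSqrt ν w)) =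
      -quadraticChar F (planeDet v w) := by
    rw [planeDet_mulSqrt_mulSqrt, map_mul, hneg, hν, neg_one_mul]
  have hself (v w : F × F) : quadraticChar F (planeDet (mulSqrt ν v) w) =
      quadraticChar F (planeDet v (mulSqrt ν w)) := by
    rw [planeDet_mulSqrt_left, hneg]
  let : LinearOrder (Option F) := LinearOrder.lift' _ (Fintype.equivFin (Option F)).injective
  let σ := projInvol ν
  have hσ : ∀ p, σ (σ p) = p := projInvol_projInvol hν0
  have hne : ∀ p, σ p ≠ p := projInvol_ne hνsq
  let ρ (i : {p // p < σ p}) : F × F := projRep i.1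
  have hproj (x y : F × F) : ∑ p, quadraticChar F (planeDet x (projRep p)) *
        quadraticChar F (planeDet y (projRep p)) =
      ∑ j, (quadraticChar F (planeDet x (ρ j)) * quadraticChar F (planeDet y (ρ j)) +
        quadraticChar F (planeDet x (mulSqrt ν (ρ j))) *
          quadraticChar F (planeDet y (mulSqrt ν (ρ j)))) := by
    rw [sum_eq_sum_lt_involution hσ hne]
    refine Finset.sum_congr rfl fun j _ => ?_
    obtain ⟨c, hc, h⟩ := exists_mulSqrt_projRep hν0 j.1
    simp only [ρ, σ, h, planeDet_smul_right, map_mul]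
    linear_combination -quadraticChar F (planeDet x (projRep (projInvol ν j))) *
      quadraticChar F (planeDet y (projRep (projInvol ν j))) * quadraticChar_sq_one hc
  have hplane (x y : F × F) : ∑ v, quadraticChar F (planeDet x v) *
        quadraticChar F (planeDet y v) = ((Fintype.card F : ℤ) - 1) *
      ∑ j, (quadraticChar F (planeDet x (ρ j)) * quadraticChar F (planeDet y (ρ j)) +
        quadraticChar F (planeDet x (mulSqrt ν (ρ j))) *
          quadraticChar F (planeDet y (mulSqrt ν (ρ j)))) := by
    rw [← hproj]
    refine sum_plane_eq_mul_sum_proj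
      (fun v => quadraticChar F (planeDet x v) * quadraticChar F (planeDet y v)) ?_ ?_
    · simp [planeDet]
    · intro c v hc
      simp only [planeDet_smul_right, map_mul]
      linear_combination quadraticChar F (planeDet x v) *
        quadraticChar F (planeDet y v) * quadraticChar_sq_one hc
  have hdet {i j} (hij : i ≠ j) : planeDet (ρ i) (ρ j) ≠ 0 := fun h =>
    hij (Subtype.ext (eq_of_planeDet_projRep_eq_zero h))
  have hdet' (i j) : planeDet (ρ i) (mulSqrt ν (ρ j)) ≠ 0 := by
    obtain ⟨c, hc, h⟩ := exists_mulSqrt_projRep hν0 j.1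
    simp only [ρ, h, planeDet_smul_right]
    refine mul_ne_zero hc fun h0 => ?_
    have hi := eq_of_planeDet_projRep_eq_zero h0
    have h1 := i.2
    have h2 := j.2
    rw [hi] at h1
    exact lt_asymm h2 (by simpa only [σ, projInvol_projInvol hν0] using h1)
  refine ⟨{p // p < σ p}, inferInstance, inferInstance,
    Matrix.of fun i j => quadraticChar F (planeDet (ρ i) (ρ j)),
    Matrix.of fun i j => quadraticChar F (planeDet (ρ i) (mulSqrt ν (ρ j))), ?_, ?_⟩
  · have := sum_eq_sum_lt_involution hσ hne (fun _ => 1)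
    simp only [Finset.sum_const, Finset.card_univ, Fintype.card_option,
      nsmul_eq_mul] at this
    push_cast at this
    omega
  · constructor
    · intro i
      simp [planeDet_self]
    · exact fun i j hij => quadraticChar_dichotomy (hdet hij)
    · exact fun i j => quadraticChar_dichotomy (hdet' i j)
    · ext i j
      simp only [Matrix.transpose_apply, Matrix.of_apply]
      rw [planeDet_swap, hneg]
    · ext i j
      simp only [Matrix.transpose_apply, Matrix.of_apply]
      rw [planeDet_swap, hneg, hself]
    · ext i k
      simp only [Matrix.add_apply, Matrix.mul_apply, Matrix.of_apply, Matrix.smul_apply,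
        ← Finset.sum_add_distrib]
      have h := hplane (ρ i) (ρ k)
      have hs1 (j) : quadraticChar F (planeDet (ρ j) (ρ k)) =
        quadraticChar F (planeDet (ρ k) (ρ j)) := by rw [planeDet_swap, hneg]
      have hs2 (j) : quadraticChar F (planeDet (ρ j) (mulSqrt ν (ρ k))) =
        quadraticChar F (planeDet (ρ k) (mulSqrt ν (ρ j))) := by
          rw [planeDet_swap, hneg, hself]
      simp only [hs1, hs2]
      apply mul_left_cancel₀ hq1
      rw [← h]
      by_cases hik : i = k
      · subst hik
        rw [sum_quadraticChar_planeDet_sq (projRep_ne_zero _)]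
        simp
      · rw [sum_quadraticChar_planeDet_mul hchar (hdet hik)]
        simp [hik]
    · ext i k
      simp only [Matrix.mul_apply, Matrix.of_apply]
      rw [← sub_eq_zero, ← Finset.sum_sub_distrib]
      have h := hplane (ρ i) (mulSqrt ν (ρ k))
      rw [sum_quadraticChar_planeDet_mul hchar (hdet' i k), eq_comm,
        mul_eq_zero, or_iff_right hq1] at h
      rw [← h]
      refine Finset.sum_congr rfl fun j _ => ?_
      have hs1 : quadraticChar F (planeDet (ρ j) (ρ k)) =
        quadraticChar F (planeDet (ρ k) (ρ j)) := by rw [planeDet_swap, hneg]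
      have hs2 : quadraticChar F (planeDet (ρ j) (mulSqrt ν (ρ k))) =
        quadraticChar F (planeDet (ρ k) (mulSqrt ν (ρ j))) := by
          rw [planeDet_swap, hneg, hself]
      rw [hconj, hs1, hs2, hself]
      ring

section Assembly

open Matrix

variable {ι : Type*} [Fintype ι] [DecidableEq ι]

/-- A skew-symmetric conference core: `[0, 1; -1, S]` is a skew conference matrix. -/
structure IsSkewCore (S : Matrix ι ι ℤ) : Prop where
  diag : ∀ i, S i i = 0
  offDiag : ∀ i j, i ≠ j → S i j = 1 ∨ S i j = -1
  skew : S.transpose = -S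
  gram : S * S.transpose = (Fintype.card ι : ℤ) • 1 - of fun _ _ => 1
  rowSum : ∀ i, ∑ j, S i j = 0

/-- The part of the array constant along each column pair, built from a skew core `S`. -/
def coreArray (S : Matrix ι ι ℤ) : Matrix ((ι ⊕ ι) ⊕ (ι ⊕ ι)) ((ι ⊕ ι) ⊕ (ι ⊕ ι)) ℤ :=
  fromBlocks 1 (fromBlocks S S S (-S)) (fromBlocks S S S (-S)) 1

/-- The part of the array alternating along each column pair, built from a conference pair. -/
def pairArray (A B : Matrix ι ι ℤ) : Matrix ((ι ⊕ ι) ⊕ (ι ⊕ ι)) ((ι ⊕ ι) ⊕ (ι ⊕ ι)) ℤ :=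
  fromBlocks (fromBlocks A B (-B) A) (fromBlocks 1 1 (-1) 1)
    (fromBlocks (-1) 1 (-1) (-1)) (fromBlocks A (-B) B A)

/-- The block containing an index of a `4 × 4` block matrix. -/
def blockIndex {α : Type*} : (α ⊕ α) ⊕ (α ⊕ α) → Fin 4
  | .inl (.inl _) => 0
  | .inl (.inr _) => 1
  | .inr (.inl _) => 2
  | .inr (.inr _) => 3

lemma entries_coreArray_pairArray {q : ℤ} {S A B : Matrix ι ι ℤ} (hS : IsSkewCore S)
    (hAB : IsConferencePair q A B) (k l : (ι ⊕ ι) ⊕ (ι ⊕ ι)) :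
    coreArray S k l = 0 ∧ (pairArray A B k l = 1 ∨ pairArray A B k l = -1) ∨
      pairArray A B k l = 0 ∧ (coreArray S k l = 1 ∨ coreArray S k l = -1) := by
  rcases k with (i | i) | (i | i) <;> rcases l with (j | j) | (j | j) <;>
    (rcases eq_or_ne i j with rfl | hij
     · have h1 := hAB.entries i i
       simp [coreArray, pairArray, hS.diag, hAB.diag]
       try grind
     · have h1 := hAB.entries i j
       have h2 := hAB.offDiag i j hij
       have h3 := hS.offDiag i j hij
       simp [coreArray, pairArray, hij]
       grind)

lemma coreArray_mul_transpose {S : Matrix ι ι ℤ} (hS : IsSkewCore S) :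
    coreArray S * (coreArray S).transpose = (2 * (Fintype.card ι : ℤ) + 1) • 1 -
      (2 : ℤ) • of fun k l => if blockIndex k = blockIndex l then (1 : ℤ) else 0 := by
  have h := hS.gram
  have hsk := hS.skew
  rw [hsk, mul_neg] at h
  simp only [coreArray, fromBlocks_transpose, fromBlocks_multiply, hsk, transpose_one,
    transpose_neg]
  ext k l
  rcases k with (i | i) | (i | i) <;> rcases l with (j | j) | (j | j) <;>
    have hij := congrFun (congrFun h i) j <;>
    simp only [Matrix.sub_apply, Matrix.smul_apply, one_apply, smul_eq_mul] at hij ⊢ <;>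
    simp [blockIndex, one_apply] at hij ⊢ <;> grind

lemma pairArray_mul_transpose {q : ℤ} {A B : Matrix ι ι ℤ} (hAB : IsConferencePair q A B) :
    pairArray A B * (pairArray A B).transpose = (q + 2) • 1 := by
  have hc := hAB.comm
  have h := hAB.sum_sq
  simp only [pairArray, fromBlocks_transpose, fromBlocks_multiply, hAB.symm_left,
    hAB.symm_right, transpose_one, transpose_neg]
  ext k l
  rcases k with (i | i) | (i | i) <;> rcases l with (j | j) | (j | j) <;>
    have hij := congrFun (congrFun h i) j <;>
    simp only [Matrix.smul_apply, one_apply, smul_eq_mul] at hij ⊢ <;>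
    simp [hc, one_apply] at hij ⊢ <;> grind

lemma sum_blockIndex_mul_coreArray {S : Matrix ι ι ℤ} (hS : IsSkewCore S) (b : Fin 4 → ℤ)
    (k : (ι ⊕ ι) ⊕ (ι ⊕ ι)) :
    ∑ l, b (blockIndex l) * coreArray S k l = b (blockIndex k) := by
  rcases k with (i | i) | (i | i) <;>
    simp [coreArray, blockIndex, one_apply, ← Finset.mul_sum, hS.rowSum]

lemma sum_blockIndex {α : Type*} [Fintype α] (b : Fin 4 → ℤ) :
    ∑ k : (α ⊕ α) ⊕ (α ⊕ α), b (blockIndex k) = Fintype.card α * ∑ i, b i := by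
  simp [blockIndex, Fin.sum_univ_four]
  ring

/-- Doubling two complementary arrays `U`, `V` and bordering them by constant blocks. -/
def borderedDouble {κ : Type*} (P Q R : Matrix (Fin 4) (Fin 4) ℤ) (p : κ → Fin 4)
    (U V : Matrix κ κ ℤ) :
    Matrix (Fin 4 ⊕ (κ ⊕ κ)) (Fin 4 ⊕ (κ ⊕ κ)) ℤ :=
  fromBlocks P (fromCols (Q.submatrix id p) (Q.submatrix id p))
    (fromRows (R.submatrix p id) (R.submatrix p id)) (fromBlocks (U + V) (U - V) (U - V) (U + V))

/-- Border coefficients compatible with `borderedDouble`. -/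
lemma exists_border : ∃ P Q R : Matrix (Fin 4) (Fin 4) ℤ,
    (∀ i j, P i j = 1 ∨ P i j = -1) ∧ (∀ i j, Q i j = 1 ∨ Q i j = -1) ∧
    (∀ i j, R i j = 1 ∨ R i j = -1) ∧
    (∀ i j, ∑ k, P i k * P j k = if i = j then 4 else 0) ∧
    (∀ i j, ∑ k, Q i k * Q j k = if i = j then 4 else 0) ∧
    (∀ i j, ∑ k, R i k * R j k = if i = j then 4 else 0) ∧
    ∀ i j, ∑ k, P i k * R j k = -2 * Q i j := by
  refine ⟨!![1, 1, 1, 1; 1, 1, -1, -1; 1, -1, 1, -1; 1, -1, -1, 1],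
    !![-1, -1, -1, 1; -1, -1, 1, -1; -1, 1, -1, -1; 1, -1, -1, -1],
    !![1, 1, 1, -1; 1, 1, -1, 1; 1, -1, 1, 1; 1, -1, -1, -1],
    ?_, ?_, ?_, by decide, by decide, by decide, by decide⟩ <;>
  · intro i j
    fin_cases i <;> fin_cases j <;> simp

/-- If `S` is a skew core and `[A, B; B, -A]` a conference matrix, both with blocks of size `n`,
then there is a Hadamard matrix of order `8 * n + 4`. -/
theorem exists_hadamard_of_skewCore_of_conferencePair {S A B : Matrix ι ι ℤ}
    (hS : IsSkewCore S) (hAB : IsConferencePair (2 * (Fintype.card ι : ℤ) - 1) A B) :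
    ∃ H : Matrix (Fin 4 ⊕ (((ι ⊕ ι) ⊕ (ι ⊕ ι)) ⊕ ((ι ⊕ ι) ⊕ (ι ⊕ ι))))
        (Fin 4 ⊕ (((ι ⊕ ι) ⊕ (ι ⊕ ι)) ⊕ ((ι ⊕ ι) ⊕ (ι ⊕ ι)))) ℤ,
      (∀ i j, H i j = 1 ∨ H i j = -1) ∧
        H * H.transpose = (8 * (Fintype.card ι : ℤ) + 4) • 1 := by
  obtain ⟨P, Q, R, hP, hQ, hR, hPP, hQQ, hRR, hPR⟩ := exists_border
  have hUU := coreArray_mul_transpose hS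
  have hVV := pairArray_mul_transpose hAB
  refine ⟨borderedDouble P Q R blockIndex (coreArray S) (pairArray A B), ?_, ?_⟩
  · rintro (i | i | i) (j | j | j)
    · exact hP i j
    · exact hQ i _
    · exact hQ i _
    · exact hR _ j
    · have := entries_coreArray_pairArray hS hAB i j
      simp only [borderedDouble, fromBlocks_apply₂₂, fromBlocks_apply₁₁, Matrix.add_apply]
      omega
    · have := entries_coreArray_pairArray hS hAB i j
      simp only [borderedDouble, fromBlocks_apply₂₂, fromBlocks_apply₁₂, Matrix.sub_apply]
      omega
    · exact hR _ j
    · have := entries_coreArray_pairArray hS hAB i j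
      simp only [borderedDouble, fromBlocks_apply₂₂, fromBlocks_apply₂₁, Matrix.sub_apply]
      omega
    · have := entries_coreArray_pairArray hS hAB i j
      simp only [borderedDouble, fromBlocks_apply₂₂, Matrix.add_apply]
      omega
  · generalize hU : coreArray S = U at *
    generalize hV : pairArray A B = V at *
    have hTT (i j) : ∑ k : (ι ⊕ ι) ⊕ (ι ⊕ ι), Q i (blockIndex k) * Q j (blockIndex k) =
        Fintype.card ι * if i = j then 4 else 0 := by
      rw [sum_blockIndex fun k => Q i k * Q j k, hQQ]
    have hQU (i k) : ∑ l, Q i (blockIndex l) * U k l = Q i (blockIndex k) := by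
      rw [← hU]
      exact sum_blockIndex_mul_coreArray hS (Q i) k
    have hUU' (k l) := congrFun (congrFun hUU k) l
    have hVV' (k l) := congrFun (congrFun hVV k) l
    simp only [mul_apply, transpose_apply, Matrix.smul_apply, Matrix.sub_apply, of_apply,
      smul_eq_mul, one_apply] at hUU' hVV'
    have hUQ (i k) : ∑ l, U k l * Q i (blockIndex l) = Q i (blockIndex k) := by
      simp only [← hQU i k, mul_comm]
    have hRP (i j) : ∑ k, R i k * P j k = -2 * Q j i := by
      simp only [← hPR j i, mul_comm]
    ext k l
    rcases k with i | i | i <;> rcases l with j | j | j <;>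
      simp only [borderedDouble, mul_apply, transpose_apply, Fintype.sum_sum_type,
        fromBlocks_apply₁₁, fromBlocks_apply₁₂, fromBlocks_apply₂₁, fromBlocks_apply₂₂,
        fromCols_apply_inl, fromCols_apply_inr, fromRows_apply_inl, fromRows_apply_inr,
        submatrix_apply, id_eq, Matrix.add_apply, Matrix.sub_apply, mul_add, mul_sub, add_mul,
        sub_mul, Matrix.smul_apply, smul_eq_mul, one_apply, Sum.inl.injEq, Sum.inr.injEq,
        reduceCtorEq, if_false, Finset.sum_add_distrib, Finset.sum_sub_distrib,
        hPP, hRR, hPR, hRP, hTT, hQU, hUQ, hUU', hVV'] <;> grind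

end Assembly

/-- Normalising a skew Hadamard matrix to have constant first row yields a skew core. -/
theorem IsSkewHadamard.exists_isSkewCore {n : ℕ} {H : Matrix (Fin (n + 1)) (Fin (n + 1)) ℤ}
    (h : IsSkewHadamard (n + 1) H) : ∃ S : Matrix (Fin n) (Fin n) ℤ, IsSkewCore S := by
  obtain ⟨⟨hent, hgram⟩, hskew⟩ := h
  have hsk (i j) : H j i - (1 : Matrix (Fin (n + 1)) (Fin (n + 1)) ℤ) j i =
      -(H i j - (1 : Matrix (Fin (n + 1)) (Fin (n + 1)) ℤ) i j) :=
    congrFun (congrFun hskew i) j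
  have hdiag (i) : H i i = 1 := by
    have := hsk i i
    simp only [Matrix.one_apply_eq] at this
    omega
  have hoff (i j) (hij : i ≠ j) : H j i = -H i j := by
    have := hsk i j
    rw [Matrix.one_apply_ne hij, Matrix.one_apply_ne hij.symm] at this
    omega
  have hrow (i k) : ∑ j, H i j * H k j = if i = k then (n : ℤ) + 1 else 0 := by
    have := congrFun (congrFun hgram i) k
    simpa [Matrix.mul_apply, Matrix.one_apply, -zsmul_eq_mul, Matrix.smul_apply] using this
  have hsq (i j) : H i j * H i j = 1 := by
    rcases hent i j with h | h <;> simp [h]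
  have hprod (i j) : H 0 i * H i j * H 0 j = 1 ∨ H 0 i * H i j * H 0 j = -1 := by
    rcases hent 0 i with h | h <;> rcases hent i j with h' | h' <;>
      rcases hent 0 j with h'' | h'' <;> simp [h, h', h'']
  let δ (i j : Fin n) : ℤ := if i = j then 1 else 0
  let S : Matrix (Fin n) (Fin n) ℤ :=
    Matrix.of fun i j => H 0 i.succ * H i.succ j.succ * H 0 j.succ - δ i j
  have hS (i j) : S i j = H 0 i.succ * H i.succ j.succ * H 0 j.succ - δ i j := rfl
  have hdiagS (i) : S i i = 0 := by
    simp [hS, δ, hdiag, hsq]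
  have hskS (i j) : S j i = -S i j := by
    by_cases hij : i = j
    · subst hij; simp [hdiagS]
    · have := hoff i.succ j.succ (by simpa using hij)
      simp only [hS, this, δ, hij, Ne.symm hij, if_false]
      ring
  have hsum (i) : ∑ j, S i j = 0 := by
    have := hrow i.succ 0
    rw [Fin.sum_univ_succ, hoff 0 i.succ (Fin.succ_ne_zero i).symm, hdiag,
      if_neg (Fin.succ_ne_zero i)] at this
    have hs : ∑ j, S i j = H 0 i.succ * ∑ j : Fin n, H i.succ j.succ * H 0 j.succ - 1 := by
      simp [hS, Finset.sum_sub_distrib, Finset.mul_sum, δ, mul_assoc]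
    rw [hs]
    linear_combination H 0 i.succ * this + hsq 0 i.succ
  refine ⟨S, hdiagS, ?_, ?_, ?_, hsum⟩
  · intro i j hij
    simpa [hS, δ, hij] using hprod i.succ j.succ
  · ext i j
    exact hskS i j
  · ext i k
    have := hrow i.succ k.succ
    rw [Fin.sum_univ_succ, hoff 0 i.succ (Fin.succ_ne_zero i).symm,
      hoff 0 k.succ (Fin.succ_ne_zero k).symm] at this
    have hs : ∑ j, (S i j + δ i j) * (S k j + δ k j) =
        H 0 i.succ * H 0 k.succ * ∑ j : Fin n, H i.succ j.succ * H k.succ j.succ := by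
      rw [Finset.mul_sum]
      refine Finset.sum_congr rfl fun j _ => ?_
      simp only [hS]
      linear_combination H 0 i.succ * H 0 k.succ * H i.succ j.succ * H k.succ j.succ *
        hsq 0 j.succ
    have hexp : ∑ j, (S i j + δ i j) * (S k j + δ k j) =
        ∑ j, S i j * S k j + S i k + S k i + δ i k := by
      simp [δ, add_mul, mul_add, Finset.sum_add_distrib]
      ring
    have hik := hskS i k
    simp only [Matrix.mul_apply, Matrix.transpose_apply, Matrix.sub_apply, Matrix.smul_apply,
      Matrix.one_apply, Matrix.of_apply, smul_eq_mul, Fintype.card_fin]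
    simp only [Fin.succ_inj] at this
    have h1 := hsq 0 i.succ
    have h2 := hsq 0 k.succ
    by_cases hik' : i = k
    · subst hik'
      simp only [δ, if_true] at *
      linear_combination hs - hexp + H 0 i.succ * H 0 i.succ * this - hik +
        (n - H 0 i.succ ^ 2) * h1
    · simp only [δ, hik', if_false] at *
      linear_combination hs - hexp + H 0 i.succ * H 0 k.succ * this - hik -
        H 0 k.succ ^ 2 * h1 - h2

theorem yamada_skew (q : ℕ) (hq : IsPrimePow q) (hq8 : q % 8 = 5)
    (h : ∃ H : Matrix (Fin ((q + 3) / 2)) (Fin ((q + 3) / 2)) ℤ,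
        IsSkewHadamard ((q + 3) / 2) H) :
    ∃ H : Matrix (Fin (4 * (q + 2))) (Fin (4 * (q + 2))) ℤ,
      IsHadamard (4 * (q + 2)) H := by
  classical
  obtain ⟨n, hn⟩ : ∃ n, q + 1 = 2 * n := ⟨(q + 1) / 2, by omega⟩
  rw [show (q + 3) / 2 = n + 1 by omega] at h
  obtain ⟨H, hH⟩ := h
  obtain ⟨S, hS⟩ := hH.exists_isSkewCore
  obtain ⟨p, k, hp, hk, rfl⟩ := (isPrimePow_nat_iff q).mp hq
  have : Fact p.Prime := ⟨hp⟩
  let : Fintype (GaloisField p k) := Fintype.ofFinite _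
  have hcard : Fintype.card (GaloisField p k) = p ^ k := by
    rw [← Nat.card_eq_fintype_card, GaloisField.card p k hk.ne']
  obtain ⟨ι, _, _, A, B, hι, hAB⟩ := exists_isConferencePair (GaloisField p k) (by omega)
  let e : Fin n ≃ ι := Fintype.equivOfCardEq (by rw [Fintype.card_fin]; omega)
  have hAB' : IsConferencePair (2 * (Fintype.card (Fin n) : ℤ) - 1)
      (A.submatrix e e) (B.submatrix e e) := by
    refine ⟨fun i => hAB.diag _, fun i j hij => hAB.offDiag _ _ (e.injective.ne hij),
      fun i j => hAB.entries _ _, ?_, ?_, ?_, ?_⟩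
    · rw [Matrix.transpose_submatrix, hAB.symm_left]
    · rw [Matrix.transpose_submatrix, hAB.symm_right]
    · have hq' : (2 * (Fintype.card (Fin n) : ℤ) - 1) = Fintype.card (GaloisField p k) := by
        rw [Fintype.card_fin, hcard]
        omega
      rw [Matrix.submatrix_mul_equiv, Matrix.submatrix_mul_equiv, hq']
      ext i j
      have := congrFun (congrFun hAB.sum_sq (e i)) (e j)
      simpa only [Matrix.submatrix_apply, Matrix.add_apply, Matrix.smul_apply, Matrix.one_apply,
        e.injective.eq_iff] using this
    · rw [Matrix.submatrix_mul_equiv, Matrix.submatrix_mul_equiv, hAB.comm]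
  obtain ⟨K, hent, hK⟩ := exists_hadamard_of_skewCore_of_conferencePair hS hAB'
  let f := (Fintype.equivFinOfCardEq
    (α := Fin 4 ⊕ (((Fin n ⊕ Fin n) ⊕ (Fin n ⊕ Fin n)) ⊕ ((Fin n ⊕ Fin n) ⊕ (Fin n ⊕ Fin n))))
    (n := 4 * (p ^ k + 2)) (by simp; omega)).symm
  refine ⟨K.submatrix f f, fun i j => hent _ _, ?_⟩
  have hq' : (8 * (Fintype.card (Fin n) : ℤ) + 4) = (4 * (p ^ k + 2) : ℕ) := by
    rw [Fintype.card_fin]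
    omega
  rw [Matrix.transpose_submatrix, Matrix.submatrix_mul_equiv, hK, hq']
  ext i j
  simp only [Matrix.submatrix_apply, Matrix.smul_apply, Matrix.one_apply, f.injective.eq_iff]
end

section
/- There exist T-sequences of length 79, i.e., TS(79) is nonvoid. -/
/-- Nonperiodic autocorrelation of the length-`m` sequence `X 0, …, X (m-1)`:
`N_X(j) = ∑_{i} X i * X (i + j)` over `i < m - j`. -/
def NAC (m : ℕ) (X : ℕ → ℤ) (j : ℕ) : ℤ :=
  ∑ i ∈ Finset.range (m - j), X i * X (i + j)
/-- T-sequences of length `n`: four `{0, ±1}`-sequences such that at each position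
`i < n` exactly one of them is nonzero, and whose nonperiodic autocorrelations
sum to zero for all shifts `j ≥ 1`. -/
def TSeq (n : ℕ) : Prop :=
  ∃ T₁ T₂ T₃ T₄ : ℕ → ℤ,
    (∀ i < n, T₁ i = 0 ∨ T₁ i = 1 ∨ T₁ i = -1) ∧
    (∀ i < n, T₂ i = 0 ∨ T₂ i = 1 ∨ T₂ i = -1) ∧
    (∀ i < n, T₃ i = 0 ∨ T₃ i = 1 ∨ T₃ i = -1) ∧
    (∀ i < n, T₄ i = 0 ∨ T₄ i = 1 ∨ T₄ i = -1) ∧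
    (∀ i < n,
      (T₁ i ≠ 0 ∧ T₂ i = 0 ∧ T₃ i = 0 ∧ T₄ i = 0) ∨
      (T₁ i = 0 ∧ T₂ i ≠ 0 ∧ T₃ i = 0 ∧ T₄ i = 0) ∨
      (T₁ i = 0 ∧ T₂ i = 0 ∧ T₃ i ≠ 0 ∧ T₄ i = 0) ∨
      (T₁ i = 0 ∧ T₂ i = 0 ∧ T₃ i = 0 ∧ T₄ i ≠ 0)) ∧
    ∀ j, 1 ≤ j → NAC n T₁ j + NAC n T₂ j + NAC n T₃ j + NAC n T₄ j = 0

/-- The nonperiodic autocorrelation vanishes at shifts at least the length. -/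
theorem NAC_eq_zero_of_le {m j : ℕ} (X : ℕ → ℤ) (h : m ≤ j) : NAC m X j = 0 := by
  simp [NAC, Nat.sub_eq_zero_of_le h]

namespace TSeq79

/-- The first of four T-sequences of length 79 built from base sequences of lengths 40, 40, 39,
39: half the sum of the two sequences of length 40. -/
def first (i : ℕ) : ℤ :=
  [0, 0, 1, 0, -1, -1, 0, 1, 0, 0, 0, 1, 1, -1, -1, 1, -1, 0, 0, 0, 0, 0, 0, 1, 1, -1, 1,
    -1, -1, 0, 0, 0, -1, 0, -1, -1, 0, -1, 0, -1].getD i 0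

/-- The second of four T-sequences of length 79 built from base sequences of lengths 40, 40, 39,
39: half the difference of the two sequences of length 40. -/
def second (i : ℕ) : ℤ :=
  [-1, -1, 0, 1, 0, 0, -1, 0, -1, 1, -1, 0, 0, 0, 0, 0, 0, -1, -1, 1, -1, -1, 1, 0, 0, 0,
    0, 0, 0, 1, 1, 1, 0, -1, 0, 0, -1, 0, -1, 0].getD i 0

/-- The third of four T-sequences of length 79 built from base sequences of lengths 40, 40, 39,
39: half the sum of the two sequences of length 39, placed after 40 zeros. -/
def third (i : ℕ) : ℤ :=
  if i < 40 then 0 else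
  [0, 0, 0, 1, -1, 0, -1, 0, -1, 0, 1, 1, 0, 0, -1, 0, 0, 1, 0, 1, 0, 1, 0, 0, 1, 0, 0,
    -1, 1, 0, -1, 0, 1, 0, 1, 1, 0, 0, 0].getD (i - 40) 0

/-- The fourth of four T-sequences of length 79 built from base sequences of lengths 40, 40, 39,
39: half the difference of the two sequences of length 39, placed after 40 zeros. -/
def fourth (i : ℕ) : ℤ :=
  if i < 40 then 0 else
  [1, -1, 1, 0, 0, 1, 0, -1, 0, -1, 0, 0, -1, 1, 0, 1, 1, 0, -1, 0, 1, 0, 1, -1, 0, 1, 1,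
    0, 0, 1, 0, -1, 0, 1, 0, 0, -1, -1, -1].getD (i - 40) 0

end TSeq79

open TSeq79

theorem tSeq_79 : TSeq 79 := by
  refine ⟨first, second, third, fourth, by decide +kernel, by decide +kernel,
    by decide +kernel, by decide +kernel, by decide +kernel, fun j hj => ?_⟩
  rcases lt_or_ge j 79 with h | h
  · have key : ∀ j < 79, 1 ≤ j →
        NAC 79 first j + NAC 79 second j + NAC 79 third j + NAC 79 fourth j = 0 := by
      decide +kernel
    exact key j h hj
  · simp only [NAC_eq_zero_of_le _ h, add_zero]
end

section
/- There exists an orthogonal design OD(4d; d,d,d,d) with d = 79, i.e., there exist four 316×316 matrices A_1, A_2, A_3, A_4 with entries in {0,+1,−1}, with pairwise disjoint supports whose union is all positions, satisfying A_i * A_iᵀ = 79·I for each i and A_i * A_jᵀ + A_j * A_iᵀ = 0 for all i ≠ j. -/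
namespace OrthogonalDesign

open Finset Matrix

section GoethalsSeidel

variable {G : Type*} [AddCommGroup G]

/-- The Goethals–Seidel array on four functions, regarded as first columns of circulants. -/
def goethalsSeidel (F : Fin 4 → G → ℤ) : Matrix (Fin 4 × G) (Fin 4 × G) ℤ :=
  fun a b =>
    !![F 0 (a.2 - b.2), F 1 (a.2 + b.2), F 2 (a.2 + b.2), F 3 (a.2 + b.2);
       -F 1 (a.2 + b.2), F 0 (a.2 - b.2), F 3 (-(a.2 + b.2)), -F 2 (-(a.2 + b.2));
       -F 2 (a.2 + b.2), -F 3 (-(a.2 + b.2)), F 0 (a.2 - b.2), F 1 (-(a.2 + b.2));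
       -F 3 (a.2 + b.2), F 2 (-(a.2 + b.2)), -F 1 (-(a.2 + b.2)), F 0 (a.2 - b.2)] a.1 b.1

theorem goethalsSeidel_apply (a b : Fin 4 × G) :
    ∃ (r : Fin 4) (x : G) (s : ℤˣ), ∀ F : Fin 4 → G → ℤ,
      goethalsSeidel F a b = s * F r x := by
  obtain ⟨p, i⟩ := a
  obtain ⟨q, j⟩ := b
  refine ⟨!![0, 1, 2, 3; 1, 0, 3, 2; 2, 3, 0, 1; 3, 2, 1, 0] p q,
    !![i - j, i + j, i + j, i + j; i + j, i - j, -(i + j), -(i + j);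
       i + j, -(i + j), i - j, -(i + j); i + j, -(i + j), -(i + j), i - j] p q,
    !![1, 1, 1, 1; -1, 1, 1, -1; -1, -1, 1, 1; -1, 1, -1, 1] p q, fun F => ?_⟩
  fin_cases p <;> fin_cases q <;> simp [goethalsSeidel]

/-- The Cooper–Wallis substitution: the coefficients of the `k`-th variable in the four
circulants built from `T`. -/
def cooperWallis {X : Type*} (T : Fin 4 → X → ℤ) (k r : Fin 4) (x : X) : ℤ :=
  !![T 0 x, T 1 x, T 2 x, T 3 x;
     T 1 x, -T 0 x, T 3 x, -T 2 x;
     T 2 x, -T 3 x, -T 0 x, T 1 x;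
     T 3 x, T 2 x, -T 1 x, -T 0 x] k r

/-- The index of the sequence occurring in each entry of the Cooper–Wallis substitution. -/
def cooperWallisIndex (k r : Fin 4) : Fin 4 :=
  !![0, 1, 2, 3; 1, 0, 3, 2; 2, 3, 0, 1; 3, 2, 1, 0] k r

theorem existsUnique_cooperWallisIndex_eq (r c : Fin 4) : ∃! k, cooperWallisIndex k r = c := by
  revert r c
  unfold ExistsUnique
  decide

theorem cooperWallis_apply {X : Type*} (T : Fin 4 → X → ℤ) (k r : Fin 4) :
    ∃ s : ℤˣ, ∀ x, cooperWallis T k r x = s * T (cooperWallisIndex k r) x := by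
  refine ⟨!![1, 1, 1, 1; 1, -1, 1, -1; 1, -1, -1, 1; 1, 1, -1, -1] k r, fun x => ?_⟩
  fin_cases k <;> fin_cases r <;> simp [cooperWallis, cooperWallisIndex]

variable [Fintype G]

/-- The periodic cross-correlation of two functions on a finite abelian group. -/
def corr (f g : G → ℤ) (x : G) : ℤ := ∑ u, f (u + x) * g u

/-- The convolution of two functions on a finite abelian group. -/
def conv (f g : G → ℤ) (x : G) : ℤ := ∑ u, f (x - u) * g u

theorem conv_comm (f g : G → ℤ) (x : G) : conv f g x = conv g f x := by
  unfold conv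
  rw [← (Equiv.subLeft x).sum_comp]
  simp [mul_comm]

theorem corr_neg (f g : G → ℤ) (x : G) : corr f g (-x) = corr g f x := by
  unfold corr
  rw [← Equiv.sum_comp (Equiv.addRight x)]
  simp [mul_comm]

theorem sum_sub_mul_sub (f g : G → ℤ) (i j : G) :
    ∑ m, f (i - m) * g (j - m) = corr f g (i - j) := by
  unfold corr
  rw [← (Equiv.subLeft j).sum_comp]
  refine sum_congr rfl fun m _ => ?_
  simp only [Equiv.subLeft_apply]
  congr 2 <;> abel

theorem sum_add_mul_add (f g : G → ℤ) (i j : G) :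
    ∑ m, f (i + m) * g (j + m) = corr f g (i - j) := by
  unfold corr
  rw [← (Equiv.subRight j).sum_comp]
  refine sum_congr rfl fun m _ => ?_
  simp only [Equiv.subRight_apply]
  congr 2 <;> abel

theorem sum_neg_add_mul_neg_add (f g : G → ℤ) (i j : G) :
    ∑ m, f (-(i + m)) * g (-(j + m)) = corr g f (i - j) := by
  rw [← corr_neg, show -(i - j) = -i - -j by abel, ← sum_sub_mul_sub]
  refine sum_congr rfl fun m _ => ?_
  congr 2 <;> abel

theorem sum_sub_mul_add (f g : G → ℤ) (i j : G) :
    ∑ m, f (i - m) * g (j + m) = conv f g (i + j) := by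
  unfold conv
  rw [← (Equiv.subRight j).sum_comp]
  refine sum_congr rfl fun m _ => ?_
  simp only [Equiv.subRight_apply]
  congr 2 <;> abel

theorem sum_add_mul_sub (f g : G → ℤ) (i j : G) :
    ∑ m, f (i + m) * g (j - m) = conv f g (i + j) := by
  rw [conv_comm, add_comm i j, ← sum_sub_mul_add]
  simp only [mul_comm]

theorem sum_neg_add_mul_add (f g : G → ℤ) (i j : G) :
    ∑ m, f (-(i + m)) * g (j + m) = conv f g (j - i) := by
  rw [sub_eq_neg_add, ← sum_sub_mul_add]
  refine sum_congr rfl fun m _ => ?_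
  congr 2
  abel

theorem sum_add_mul_neg_add (f g : G → ℤ) (i j : G) :
    ∑ m, f (i + m) * g (-(j + m)) = conv f g (i - j) := by
  rw [conv_comm, ← sum_neg_add_mul_add]
  simp only [mul_comm]

theorem sum_sub_mul_neg_add (f g : G → ℤ) (i j : G) :
    ∑ m, f (i - m) * g (-(j + m)) = corr f g (i + j) := by
  rw [← sub_neg_eq_add, ← sum_sub_mul_sub]
  refine sum_congr rfl fun m _ => ?_
  congr 2
  abel

theorem sum_neg_add_mul_sub (f g : G → ℤ) (i j : G) :
    ∑ m, f (-(i + m)) * g (j - m) = corr g f (i + j) := by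
  rw [add_comm, ← sum_sub_mul_neg_add]
  simp only [mul_comm]

theorem goethalsSeidel_mul_transpose_add (F F' : Fin 4 → G → ℤ) (a b : Fin 4 × G) :
    (goethalsSeidel F * (goethalsSeidel F')ᵀ + goethalsSeidel F' * (goethalsSeidel F)ᵀ) a b =
      if a.1 = b.1 then
        ∑ r, (corr (F r) (F' r) (a.2 - b.2) + corr (F' r) (F r) (a.2 - b.2)) else 0 := by
  obtain ⟨p, i⟩ := a
  obtain ⟨q, j⟩ := b
  simp only [Matrix.add_apply, mul_apply, transpose_apply, Fintype.sum_prod_type,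
    Fin.sum_univ_four]
  fin_cases p <;> fin_cases q <;>
    simp [goethalsSeidel, -neg_add_rev, sum_sub_mul_sub, sum_add_mul_add,
      sum_neg_add_mul_neg_add, sum_sub_mul_add, sum_add_mul_sub, sum_neg_add_mul_add,
      sum_add_mul_neg_add, sum_sub_mul_neg_add, sum_neg_add_mul_sub,
      fun r => conv_comm (F' r)] <;>
    ring

theorem sum_corr_cooperWallis_self (T : Fin 4 → G → ℤ) (k : Fin 4) (x : G) :
    ∑ r, corr (cooperWallis T k r) (cooperWallis T k r) x = ∑ r, corr (T r) (T r) x := by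
  simp only [Fin.sum_univ_four]
  fin_cases k <;> simp [cooperWallis, corr] <;> ring

theorem sum_corr_cooperWallis_of_ne (T : Fin 4 → G → ℤ) {k l : Fin 4} (h : k ≠ l) (x : G) :
    ∑ r, (corr (cooperWallis T k r) (cooperWallis T l r) x +
      corr (cooperWallis T l r) (cooperWallis T k r) x) = 0 := by
  simp only [Fin.sum_univ_four]
  fin_cases k <;> fin_cases l <;> first | exact absurd rfl h | skip
  all_goals simp [cooperWallis, corr]; try ring

end GoethalsSeidel

/-- Four disjoint `{0, 1, -1}`-sequences of length 79 whose periodic autocorrelations sum to zero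
at every nonzero shift; the supports of the positive and negative parts are given as bit masks. -/
def tSequence (c : Fin 4) (x : Fin 79) : ℤ :=
  (((![302231563628317294465542, 28371092396360407711744,
      151115727733690707509280, 608743697924508090504] : Fin 4 → ℕ) c).testBit x).toNat -
  (((![3542810830826603823168, 37860793793521314375696,
      147576205489001725953, 80584601521184749651200] : Fin 4 → ℕ) c).testBit x).toNat

theorem sum_corr_tSequence (x : Fin 79) :
    ∑ c, corr (tSequence c) (tSequence c) x = if x = 0 then 79 else 0 := by
  revert x
  unfold corr
  decide +kernel

theorem tSequence_mem (c : Fin 4) (x : Fin 79) :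
    tSequence c x = 0 ∨ tSequence c x = 1 ∨ tSequence c x = -1 := by
  revert c x
  decide +kernel

theorem exists_tSequence_ne_zero_iff (x : Fin 79) : ∃ c, ∀ d, tSequence d x ≠ 0 ↔ d = c := by
  revert x
  decide +kernel

theorem cooperWallis_tSequence_mem (k r : Fin 4) (x : Fin 79) :
    cooperWallis tSequence k r x = 0 ∨ cooperWallis tSequence k r x = 1 ∨
      cooperWallis tSequence k r x = -1 := by
  obtain ⟨s, h⟩ := cooperWallis_apply tSequence k r
  rw [h]
  rcases Int.units_eq_one_or s with rfl | rfl <;>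
    rcases tSequence_mem (cooperWallisIndex k r) x with h | h | h <;> simp [h]

theorem existsUnique_cooperWallis_tSequence_ne_zero (r : Fin 4) (x : Fin 79) :
    ∃! k, cooperWallis tSequence k r x ≠ 0 := by
  obtain ⟨c, hc⟩ := exists_tSequence_ne_zero_iff x
  have h (k : Fin 4) : cooperWallis tSequence k r x ≠ 0 ↔ cooperWallisIndex k r = c := by
    obtain ⟨s, h⟩ := cooperWallis_apply tSequence k r
    rw [h, mul_ne_zero_iff_left s.ne_zero, hc]
  simpa only [h] using existsUnique_cooperWallisIndex_eq r c

theorem goethalsSeidel_tSequence_mul_transpose (k : Fin 4) :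
    goethalsSeidel (cooperWallis tSequence k) * (goethalsSeidel (cooperWallis tSequence k))ᵀ =
      (79 : ℤ) • 1 := by
  ext a b
  have h := goethalsSeidel_mul_transpose_add (cooperWallis tSequence k)
    (cooperWallis tSequence k) a b
  rw [sum_add_distrib, sum_corr_cooperWallis_self, sum_corr_tSequence, Matrix.add_apply] at h
  simp only [sub_eq_zero] at h
  simp only [Matrix.smul_apply, Matrix.one_apply, Prod.ext_iff]
  split_ifs at h ⊢ <;> simp_all
  omega

end OrthogonalDesign

open OrthogonalDesign

theorem od_316 :
    ∃ A : Fin 4 → Matrix (Fin 316) (Fin 316) ℤ,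
      (∀ k i j, A k i j = 0 ∨ A k i j = 1 ∨ A k i j = -1) ∧
      (∀ i j, ∃! k, A k i j ≠ 0) ∧
      (∀ k, A k * (A k).transpose = (79 : ℤ) • 1) ∧
      (∀ k l, k ≠ l → A k * (A l).transpose + A l * (A k).transpose = 0) := by
  let e : Fin 316 ≃ Fin 4 × Fin 79 := (finProdFinEquiv (m := 4) (n := 79)).symm
  refine ⟨fun k => (goethalsSeidel (cooperWallis tSequence k)).submatrix e e,
    fun k i j => ?_, fun i j => ?_, fun k => ?_, fun k l hkl => ?_⟩
  · obtain ⟨r, x, s, h⟩ := goethalsSeidel_apply (e i) (e j)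
    simp only [Matrix.submatrix_apply, h]
    rcases Int.units_eq_one_or s with rfl | rfl <;>
      rcases cooperWallis_tSequence_mem k r x with h | h | h <;> simp [h]
  · obtain ⟨r, x, s, h⟩ := goethalsSeidel_apply (e i) (e j)
    simpa only [Matrix.submatrix_apply, h, ne_eq, mul_eq_zero, s.ne_zero, false_or] using
      existsUnique_cooperWallis_tSequence_ne_zero r x
  · rw [Matrix.transpose_submatrix, Matrix.submatrix_mul_equiv,
      goethalsSeidel_tSequence_mul_transpose]
    ext i j
    simp only [Matrix.submatrix_apply, Matrix.smul_apply, Matrix.one_apply, e.injective.eq_iff]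
  · rw [Matrix.transpose_submatrix, Matrix.transpose_submatrix, Matrix.submatrix_mul_equiv,
      Matrix.submatrix_mul_equiv]
    ext i j
    have h := goethalsSeidel_mul_transpose_add (cooperWallis tSequence k)
      (cooperWallis tSequence l) (e i) (e j)
    rwa [sum_corr_cooperWallis_of_ne _ hkl, ite_self] at h
end

section
/- For all nonnegative integers a, b, c, base sequences BS(n+1, n) exist for the Golay number n = 2^a · 10^b · 26^c. -/
/-- Base sequences `BS(m, n)`: four `±1`-sequences `A, B` of length `m` and
`C, D` of length `n` whose nonperiodic autocorrelations sum to zero for `j ≥ 1`. -/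
def BaseSeq (m n : ℕ) : Prop :=
  ∃ A B C D : ℕ → ℤ,
    (∀ i < m, A i = 1 ∨ A i = -1) ∧
    (∀ i < m, B i = 1 ∨ B i = -1) ∧
    (∀ i < n, C i = 1 ∨ C i = -1) ∧
    (∀ i < n, D i = 1 ∨ D i = -1) ∧
    ∀ j, 1 ≤ j → NAC m A j + NAC m B j + NAC n C j + NAC n D j = 0

open Polynomial in
/-- The generating polynomial `∑ f i * x ^ i` of the first `m` terms of a sequence. -/
noncomputable def seqPoly (m : ℕ) (f : ℕ → ℤ) : ℤ[X] :=
  ∑ i ∈ Finset.range m, C (f i) * X ^ i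

/-- The reversal of the first `m` terms of a sequence. -/
def seqRev (m : ℕ) (f : ℕ → ℤ) (i : ℕ) : ℤ := f (m - 1 - i)

/-- The Kronecker product of a sequence `f` of length `m` with a sequence `g`, as a sequence made
of the blocks `g k • f`. -/
def seqKron (m : ℕ) (f g : ℕ → ℤ) (i : ℕ) : ℤ := f (i % m) * g (i / m)

open Polynomial in
/-- A Golay pair of length `m`: two `±1`-sequences with complementary autocorrelations, expressed
through generating polynomials. -/
def IsGolayPair (m : ℕ) (A B : ℕ → ℤ) : Prop :=
  (∀ i < m, A i = 1 ∨ A i = -1) ∧ (∀ i < m, B i = 1 ∨ B i = -1) ∧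
    seqPoly m A * seqPoly m (seqRev m A) + seqPoly m B * seqPoly m (seqRev m B) =
      C (2 * m : ℤ) * X ^ (m - 1)

lemma seqPoly_congr {m : ℕ} {f g : ℕ → ℤ} (h : ∀ i < m, f i = g i) :
    seqPoly m f = seqPoly m g :=
  Finset.sum_congr rfl fun i hi => by rw [h i (Finset.mem_range.1 hi)]

lemma seqPoly_add (m : ℕ) (f g : ℕ → ℤ) :
    seqPoly m (f + g) = seqPoly m f + seqPoly m g := by
  simp [seqPoly, add_mul, Finset.sum_add_distrib]

lemma seqPoly_sub (m : ℕ) (f g : ℕ → ℤ) :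
    seqPoly m (f - g) = seqPoly m f - seqPoly m g := by
  simp [seqPoly, sub_mul, Finset.sum_sub_distrib]

lemma seqPoly_two_mul (m : ℕ) (f : ℕ → ℤ) :
    seqPoly m (2 * f) = 2 * seqPoly m f := by
  rw [two_mul, seqPoly_add, two_mul]

lemma seqRev_add (m : ℕ) (f g : ℕ → ℤ) : seqRev m (f + g) = seqRev m f + seqRev m g := rfl

lemma seqRev_sub (m : ℕ) (f g : ℕ → ℤ) : seqRev m (f - g) = seqRev m f - seqRev m g := rfl

lemma seqPoly_seqRev_seqRev (m : ℕ) (f : ℕ → ℤ) :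
    seqPoly m (seqRev m (seqRev m f)) = seqPoly m f :=
  seqPoly_congr fun i hi => by
    simp only [seqRev]
    congr 1
    omega

lemma seqPoly_seqKron (m n : ℕ) (f g : ℕ → ℤ) :
    seqPoly (m * n) (seqKron m f g) =
      seqPoly m f * Polynomial.expand ℤ m (seqPoly n g) := by
  induction n with
  | zero => simp [seqPoly]
  | succ n ih =>
    have hs : seqPoly (n + 1) g = seqPoly n g + .C (g n) * .X ^ n :=
      Finset.sum_range_succ _ _
    rw [hs, map_add, mul_add (seqPoly m f), ← ih, mul_add_one, seqPoly, Finset.sum_range_add]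
    congr 1
    simp only [seqPoly, map_mul, map_pow, Polynomial.expand_C, Polynomial.expand_X,
      Finset.sum_mul]
    refine Finset.sum_congr rfl fun r hr => ?_
    have hr := Finset.mem_range.1 hr
    have hd : (m * n + r) / m = n := by
      rw [Nat.mul_add_div (by omega), Nat.div_eq_of_lt hr, add_zero]
    rw [seqKron, hd, Nat.mul_add_mod, Nat.mod_eq_of_lt hr, map_mul]
    ring

lemma seqPoly_seqRev_seqKron (m n : ℕ) (f g : ℕ → ℤ) :
    seqPoly (m * n) (seqRev (m * n) (seqKron m f g)) =
      seqPoly m (seqRev m f) * Polynomial.expand ℤ m (seqPoly n (seqRev n g)) := by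
  rw [← seqPoly_seqKron]
  refine seqPoly_congr fun i hi => ?_
  have hm : 0 < m := Nat.pos_of_mul_pos_right (by omega : 0 < m * n)
  have hr := Nat.mod_lt i hm
  have hk : i / m < n := Nat.div_lt_of_lt_mul hi
  have he : m * n - 1 - i = m * (n - 1 - i / m) + (m - 1 - i % m) := by
    obtain ⟨t, rfl⟩ : ∃ t, n = i / m + t + 1 := ⟨n - i / m - 1, by omega⟩
    have h1 := Nat.div_add_mod i m
    have h2 : i / m + t + 1 - 1 - i / m = t := by omega
    rw [h2]
    have h3 : m * (i / m + t + 1) = m * (i / m) + m * t + m := by ring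
    omega
  have hlt : m - 1 - i % m < m := by omega
  simp only [seqRev, seqKron]
  rw [he, Nat.mul_add_div hm, Nat.div_eq_of_lt hlt, add_zero, Nat.mul_add_mod,
    Nat.mod_eq_of_lt hlt]

/-- Coefficients of `f(x) * (x ^ (m - 1) * f(1 / x))` are autocorrelations of `f`. -/
lemma coeff_seqPoly_mul_seqRev {m j : ℕ} (hj : j < m) (f : ℕ → ℤ) :
    (seqPoly m f * seqPoly m (seqRev m f)).coeff (m - 1 - j) = NAC m f j := by
  have hrev : seqPoly m (seqRev m f) =
      ∑ k ∈ Finset.range m, Polynomial.C (f k) * Polynomial.X ^ (m - 1 - k) := by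
    rw [← Finset.sum_range_reflect]
    refine Finset.sum_congr rfl fun i hi => ?_
    have := Finset.mem_range.1 hi
    rw [seqRev, show m - 1 - (m - 1 - i) = i by omega]
  have hterm : ∀ i ∈ Finset.range m,
      (∑ k ∈ Finset.range m, (Polynomial.C (f i) * Polynomial.X ^ i *
        (Polynomial.C (f k) * Polynomial.X ^ (m - 1 - k))).coeff (m - 1 - j)) =
      if i < m - j then f i * f (i + j) else 0 := by
    intro i hi
    have hk : ∀ k ∈ Finset.range m, (Polynomial.C (f i) * Polynomial.X ^ i *
        (Polynomial.C (f k) * Polynomial.X ^ (m - 1 - k))).coeff (m - 1 - j) =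
        if k = i + j then f i * f k else 0 := by
      intro k hk
      have hk := Finset.mem_range.1 hk
      rw [show Polynomial.C (f i) * Polynomial.X ^ i *
        (Polynomial.C (f k) * Polynomial.X ^ (m - 1 - k)) =
        Polynomial.C (f i * f k) * Polynomial.X ^ (i + (m - 1 - k)) by
          rw [map_mul, pow_add]; ring, Polynomial.coeff_C_mul_X_pow]
      exact if_congr (by omega) rfl rfl
    rw [Finset.sum_congr rfl hk, Finset.sum_ite_eq']
    exact if_congr (by rw [Finset.mem_range]; omega) rfl rfl
  rw [hrev, seqPoly, Finset.sum_mul_sum]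
  simp only [Polynomial.finsetSum_coeff]
  rw [Finset.sum_congr rfl hterm, ← Finset.sum_filter, NAC]
  refine Finset.sum_congr ?_ fun _ _ => rfl
  ext i
  simp only [Finset.mem_filter, Finset.mem_range]
  omega

lemma IsGolayPair.nac_add_nac {m : ℕ} {A B : ℕ → ℤ} (h : IsGolayPair m A B) {j : ℕ}
    (hj : 1 ≤ j) : NAC m A j + NAC m B j = 0 := by
  rcases lt_or_ge j m with hjm | hjm
  · rw [← coeff_seqPoly_mul_seqRev hjm, ← coeff_seqPoly_mul_seqRev hjm, ← Polynomial.coeff_add,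
      h.2.2, Polynomial.coeff_C_mul_X_pow, if_neg (by omega)]
  · simp [NAC, Nat.sub_eq_zero_of_le hjm]

/-- Turyn's multiplication of Golay pairs. -/
lemma IsGolayPair.mul {m n : ℕ} {A B F G : ℕ → ℤ} (h₁ : IsGolayPair m A B)
    (h₂ : IsGolayPair n F G) (hm : 0 < m) (hn : 0 < n) :
    ∃ U V, IsGolayPair (m * n) U V := by
  obtain ⟨hA, hB, hAB⟩ := h₁
  obtain ⟨hF, hG, hFG⟩ := h₂
  let U : ℕ → ℤ := fun i =>
    if F (i / m) = G (i / m) then A (i % m) * F (i / m) else seqRev m B (i % m) * F (i / m)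
  let V : ℕ → ℤ := fun i =>
    if F (i / m) = G (i / m) then B (i % m) * F (i / m) else -(seqRev m A (i % m) * F (i / m))
  have hmod : ∀ i, i % m < m := fun i => Nat.mod_lt i hm
  have hdiv : ∀ i < m * n, i / m < n := fun i hi => Nat.div_lt_of_lt_mul hi
  have hU : ∀ i < m * n, (2 * U) i =
      (seqKron m A (F + G) + seqKron m (seqRev m B) (F - G)) i := by
    intro i hi
    simp only [U, seqKron, Pi.add_apply, Pi.sub_apply, Pi.mul_apply, Pi.ofNat_apply]
    rcases hF _ (hdiv i hi) with h | h <;> rcases hG _ (hdiv i hi) with h' | h' <;>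
      rw [h, h'] <;> norm_num <;> ring
  have hV : ∀ i < m * n, (2 * V) i =
      (seqKron m B (F + G) - seqKron m (seqRev m A) (F - G)) i := by
    intro i hi
    simp only [V, seqKron, Pi.add_apply, Pi.sub_apply, Pi.mul_apply, Pi.ofNat_apply]
    rcases hF _ (hdiv i hi) with h | h <;> rcases hG _ (hdiv i hi) with h' | h' <;>
      rw [h, h'] <;> norm_num <;> ring
  have hrev {f g : ℕ → ℤ} (h : ∀ i < m * n, (2 * f) i = g i) :
      2 * seqPoly (m * n) (seqRev (m * n) f) = seqPoly (m * n) (seqRev (m * n) g) := by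
    rw [← seqPoly_two_mul]
    exact seqPoly_congr fun i hi => h (m * n - 1 - i) (by omega)
  have hpU : 2 * seqPoly (m * n) U = _ := (seqPoly_two_mul _ _).symm.trans (seqPoly_congr hU)
  have hpV : 2 * seqPoly (m * n) V = _ := (seqPoly_two_mul _ _).symm.trans (seqPoly_congr hV)
  have hrU := hrev hU
  have hrV := hrev hV
  simp only [seqRev_add, seqRev_sub, seqPoly_add, seqPoly_sub, seqPoly_seqKron,
    seqPoly_seqRev_seqKron, seqPoly_seqRev_seqRev, map_add, map_sub] at hpU hpV hrU hrV
  have hsign {a b : ℤ} (ha : a = 1 ∨ a = -1) (hb : b = 1 ∨ b = -1) :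
      a * b = 1 ∨ a * b = -1 := by
    rcases ha with rfl | rfl <;> rcases hb with rfl | rfl <;> simp
  refine ⟨U, V, fun i hi => ?_, fun i hi => ?_, ?_⟩
  · simp only [U]
    split_ifs
    · exact hsign (hA _ (hmod i)) (hF _ (hdiv i hi))
    · exact hsign (hB _ (by omega)) (hF _ (hdiv i hi))
  · simp only [V]
    split_ifs
    · exact hsign (hB _ (hmod i)) (hF _ (hdiv i hi))
    · rw [neg_eq_iff_eq_neg, neg_inj]
      exact (hsign (hA _ (by omega)) (hF _ (hdiv i hi))).symm
  · have hFG' := congrArg (Polynomial.expand ℤ m) hFG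
    simp only [map_add, map_mul, map_pow, Polynomial.expand_C, Polynomial.expand_X] at hFG'
    have hexp : m * n - 1 = m - 1 + m * (n - 1) := by
      obtain ⟨k, rfl⟩ : ∃ k, n = k + 1 := ⟨n - 1, by omega⟩
      rw [mul_add, mul_one, Nat.add_sub_cancel]
      omega
    rw [← pow_mul] at hFG'
    rw [hexp, pow_add]
    apply mul_left_cancel₀ (by norm_num : (4 : Polynomial ℤ) ≠ 0)
    calc 4 * (seqPoly (m * n) U * seqPoly (m * n) (seqRev (m * n) U) +
          seqPoly (m * n) V * seqPoly (m * n) (seqRev (m * n) V))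
        = (2 * seqPoly (m * n) U) * (2 * seqPoly (m * n) (seqRev (m * n) U)) +
          (2 * seqPoly (m * n) V) * (2 * seqPoly (m * n) (seqRev (m * n) V)) := by ring
      _ = 2 * ((Polynomial.C (2 * m : ℤ) * Polynomial.X ^ (m - 1)) *
          (Polynomial.C (2 : ℤ) * Polynomial.C (n : ℤ) * Polynomial.X ^ (m * (n - 1)))) := by
        rw [hpU, hpV, hrU, hrV, ← hAB, ← hFG']
        ring
      _ = _ := by
        push_cast
        simp only [map_mul, map_ofNat]
        ring

lemma isGolayPair_one : IsGolayPair 1 (fun _ => 1) (fun _ => 1) := by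
  refine ⟨by simp, by simp, ?_⟩
  simp [seqPoly, seqRev]
  norm_num

lemma isGolayPair_two : IsGolayPair 2 (fun _ => 1) (fun i => [1, -1].getD i 0) := by
  refine ⟨by decide, by decide, ?_⟩
  simp [seqPoly, seqRev, Finset.sum_range_succ]
  ring

lemma isGolayPair_ten : IsGolayPair 10
    (fun i => [1, 1, -1, 1, -1, 1, -1, -1, 1, 1].getD i 0)
    (fun i => [1, 1, -1, 1, 1, 1, 1, 1, -1, -1].getD i 0) := by
  refine ⟨by decide, by decide, ?_⟩
  simp [seqPoly, seqRev, Finset.sum_range_succ]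
  ring

lemma isGolayPair_twenty_six : IsGolayPair 26
    (fun i => [1, 1, 1, 1, -1, 1, 1, -1, -1, 1, -1, 1, -1, 1, -1, -1, 1, -1, 1, 1, 1, -1, -1, 1,
      1, 1].getD i 0)
    (fun i => [1, 1, 1, 1, -1, 1, 1, -1, -1, 1, -1, 1, 1, 1, 1, 1, -1, 1, -1, -1, -1, 1, 1, -1,
      -1, -1].getD i 0) := by
  refine ⟨by decide, by decide, ?_⟩
  simp [seqPoly, seqRev, Finset.sum_range_succ]
  ring

lemma exists_isGolayPair_mul_pow {k n : ℕ} (hk : 0 < k) (hn : 0 < n)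
    (hK : ∃ A B, IsGolayPair k A B) (hN : ∃ A B, IsGolayPair n A B) (a : ℕ) :
    ∃ A B, IsGolayPair (n * k ^ a) A B := by
  induction a with
  | zero => simpa using hN
  | succ a ih =>
    obtain ⟨A, B, h⟩ := ih
    obtain ⟨F, G, h'⟩ := hK
    rw [pow_succ, ← mul_assoc]
    exact h.mul h' (by positivity) hk

/-- A Golay pair `F, G` gives the base sequences `(F, 1), (F, -1), G, G`. -/
lemma IsGolayPair.baseSeq {n : ℕ} {F G : ℕ → ℤ} (h : IsGolayPair n F G) :
    BaseSeq (n + 1) n := by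
  have hnac (e : ℤ) {j : ℕ} (hj : 1 ≤ j) : NAC (n + 1) (Function.update F n e) j =
      NAC n F j + if j ≤ n then F (n - j) * e else 0 := by
    have hlow : ∀ i ∈ Finset.range (n - j),
        Function.update F n e i * Function.update F n e (i + j) = F i * F (i + j) := by
      intro i hi
      have := Finset.mem_range.1 hi
      rw [Function.update_of_ne (by omega), Function.update_of_ne (by omega)]
    rw [NAC, NAC]
    split_ifs with hjn
    · rw [Nat.sub_add_comm hjn, Finset.sum_range_succ, Finset.sum_congr rfl hlow,
        Nat.sub_add_cancel hjn, Function.update_self, Function.update_of_ne (by omega)]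
    · rw [show n + 1 - j = n - j by omega, Finset.sum_congr rfl hlow, add_zero]
  have hsign (e : ℤ) (he : e = 1 ∨ e = -1) :
      ∀ i < n + 1, Function.update F n e i = 1 ∨ Function.update F n e i = -1 := by
    intro i hi
    rcases eq_or_ne i n with rfl | hin
    · rwa [Function.update_self]
    · rw [Function.update_of_ne hin]
      exact h.1 i (by omega)
  refine ⟨Function.update F n 1, Function.update F n (-1), G, G, hsign 1 (.inl rfl),
    hsign (-1) (.inr rfl), h.2.1, h.2.1, fun j hj => ?_⟩
  have hFG := h.nac_add_nac hj
  rw [hnac 1 hj, hnac (-1) hj]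
  split_ifs <;> linarith

theorem baseSeq_golay (a b c : ℕ) :
    BaseSeq (2 ^ a * 10 ^ b * 26 ^ c + 1) (2 ^ a * 10 ^ b * 26 ^ c) := by
  have h₁ : ∃ A B, IsGolayPair (2 ^ a) A B := by
    simpa using exists_isGolayPair_mul_pow two_pos one_pos ⟨_, _, isGolayPair_two⟩
      ⟨_, _, isGolayPair_one⟩ a
  have h₂ := exists_isGolayPair_mul_pow (by norm_num) (by positivity) ⟨_, _, isGolayPair_ten⟩ h₁ b
  obtain ⟨F, G, h⟩ :=
    exists_isGolayPair_mul_pow (by norm_num) (by positivity) ⟨_, _, isGolayPair_twenty_six⟩ h₂ c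
  exact h.baseSeq
end
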